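/- arXiv:1604.00765 — 5 statements merged into one kernel-verified Lean document; each statement's English description precedes it below -/
import Mathlib

section
/- (Hurwitz) For every irrational real number x there exist infinitely many rationals p/q (with p, q coprime integers, q ≥ 1) such that |x − p/q| < 1/(√5·q²). Moreover, the constant 1/√5 is best possible: for the golden ratio x = (1+√5)/2 and any constant c < 1/√5, the inequality |x − p/q| < c/q² has only finitely many rational solutions p/q. -/
theorem Irrational.intCast_mul_sub_intCast_ne_zero {x : ℝ} (hx : Irrational x) (p : ℤ) {q : ℤ}
    (hq : q ≠ 0) : (q : ℝ) * x - p ≠ 0 :=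
  ((hx.intCast_mul hq).sub_intCast p).ne_zero

theorem abs_sub_div_lt_div_iff {x p q c : ℝ} (hq : 0 < q) :
    |x - p / q| < c / q ↔ |q * x - p| < c := by
  have h : x - p / q = (q * x - p) / q := by field_simp
  rw [h, abs_div, abs_of_pos hq, div_lt_div_iff_of_pos_right hq]

/-- Two consecutive Farey fractions, with denominators `b` and `d`, enclosing an irrational number:
there are such fractions with `b + d` arbitrarily large. -/
theorem exists_farey_interval {x : ℝ} (hx : Irrational x) (n : ℕ) :
    ∃ a b c d : ℤ, 0 < b ∧ 0 < d ∧ b * c - a * d = 1 ∧ 0 < (b : ℝ) * x - a ∧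
      (d : ℝ) * x - c < 0 ∧ (n : ℤ) < b + d := by
  induction n with
  | zero =>
    refine ⟨⌊x⌋, 1, ⌊x⌋ + 1, 1, one_pos, one_pos, by ring, ?_, ?_, by norm_num⟩
    · have h := hx.intCast_mul_sub_intCast_ne_zero ⌊x⌋ one_ne_zero
      refine lt_of_le_of_ne ?_ h.symm
      simp
    · have := Int.lt_floor_add_one x
      push_cast
      linarith
  | succ n ih =>
    obtain ⟨a, b, c, d, hb, hd, hdet, ha, hc, hn⟩ := ih
    have h := hx.intCast_mul_sub_intCast_ne_zero (a + c) (add_pos hb hd).ne'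
    rcases h.lt_or_gt with h | h
    · exact ⟨a, b, a + c, b + d, hb, add_pos hb hd, by linarith, ha, h, by push_cast; linarith⟩
    · exact ⟨a + c, b + d, c, d, add_pos hb hd, hd, by linarith, h, hc, by push_cast; linarith⟩

theorem sq_add_sq_le_of_one_le {k s t P Q : ℝ} (h : t * P + s * Q = 1)
    (hP : 1 ≤ k * (s * P)) (hQ : 1 ≤ k * (t * Q)) : s ^ 2 + t ^ 2 ≤ k * (s * t) := by
  have h₁ := mul_le_mul_of_nonneg_left hP (sq_nonneg t)
  have h₂ := mul_le_mul_of_nonneg_left hQ (sq_nonneg s)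
  linear_combination h₁ + h₂ + k * (s * t) * h

theorem irrational_sqrt_five : Irrational √5 := by
  simpa using Nat.Prime.irrational_sqrt (show Nat.Prime 5 by norm_num)

theorem not_sq_add_sq_le_sqrt_five {s t : ℤ} (hs : s ≠ 0)
    (h₁ : (s : ℝ) ^ 2 + (t : ℝ) ^ 2 ≤ √5 * (s * t))
    (h₂ : (s : ℝ) ^ 2 + ((s : ℝ) + t) ^ 2 ≤ √5 * (s * (s + t))) : False := by
  have h5 : √5 ^ 2 = 5 := Real.sq_sqrt (by norm_num)
  have hne := irrational_sqrt_five.intCast_mul_sub_intCast_ne_zero (s + 2 * t) hs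
  push_cast at hne
  have := sq_pos_of_ne_zero hne
  nlinarith

/-- One of two consecutive Farey fractions enclosing `x` and their mediant is a good
approximation of `x`. -/
theorem exists_sqrt_five_mul_lt_one {x : ℝ} {a b c d : ℤ} (hb : 0 < b) (hd : 0 < d)
    (hdet : b * c - a * d = 1) (ha : 0 < (b : ℝ) * x - a) (hc : (d : ℝ) * x - c < 0) :
    ∃ p q : ℤ, 0 < q ∧ IsCoprime p q ∧ √5 * (q * |q * x - p|) < 1 ∧
      (b * d : ℝ) * |q * x - p| < q := by
  have hb' : (0 : ℝ) < b := by exact_mod_cast hb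
  have hd' : (0 : ℝ) < d := by exact_mod_cast hd
  have hdet' : (b : ℝ) * c - a * d = 1 := by exact_mod_cast hdet
  have hP : (b * d : ℝ) * (b * x - a) < b := by
    nlinarith [mul_neg_of_pos_of_neg (mul_pos hb' hb') hc]
  have hQ : (b * d : ℝ) * (c - d * x) < d := by
    nlinarith [mul_pos (mul_pos hd' hd') ha]
  by_contra! H
  have h₁ := not_lt.1 fun h ↦ (H a b hb ⟨-d, c, by linarith⟩ h).not_gt
    (by rwa [abs_of_pos ha])
  have h₂ := not_lt.1 fun h ↦ (H c d hd ⟨b, -a, by linarith⟩ h).not_gt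
    (by rwa [abs_of_neg hc, neg_sub])
  have h₃ := not_lt.1 fun h ↦ (H (a + c) (b + d) (add_pos hb hd) ⟨-d, c, by linarith⟩ h).not_gt (by
    rw [← abs_of_pos (mul_pos hb' hd'), ← abs_mul, abs_lt]
    push_cast
    constructor <;> linarith [mul_pos (mul_pos hb' hd') ha,
      mul_neg_of_pos_of_neg (mul_pos hb' hd') hc])
  rw [abs_of_pos ha] at h₁
  rw [abs_of_neg hc] at h₂
  push_cast at h₃
  have h₁₂ := sq_add_sq_le_of_one_le (by linear_combination hdet') h₁ h₂
  rcases abs_cases ((b + d : ℝ) * x - (a + c)) with ⟨h, -⟩ | ⟨h, -⟩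
  · rw [h] at h₃
    refine not_sq_add_sq_le_sqrt_five hd.ne' (t := b) (by linarith) ?_
    have := sq_add_sq_le_of_one_le (by linear_combination hdet') h₂ h₃
    linarith
  · rw [h] at h₃
    refine not_sq_add_sq_le_sqrt_five hb.ne' h₁₂ ?_
    have := sq_add_sq_le_of_one_le (by linear_combination hdet') h₁ h₃
    linarith

theorem infinite_abs_sub_div_lt_one_div_sqrt_five {x : ℝ} (hx : Irrational x) :
    {pq : ℤ × ℤ | 1 ≤ pq.2 ∧ IsCoprime pq.1 pq.2 ∧
      |x - (pq.1 : ℝ) / (pq.2 : ℝ)| < 1 / (√5 * (pq.2 : ℝ) ^ 2)}.Infinite := by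
  intro hfin
  have hev : ∀ᶠ n : ℕ in Filter.atTop, ∀ pq ∈ {pq : ℤ × ℤ | 1 ≤ pq.2 ∧ IsCoprime pq.1 pq.2 ∧
      |x - (pq.1 : ℝ) / (pq.2 : ℝ)| < 1 / (√5 * (pq.2 : ℝ) ^ 2)},
      1 / (n : ℝ) < |x - pq.1 / pq.2| := by
    refine (Filter.eventually_all_finite hfin).2 fun pq _ ↦ ?_
    have hne : x - (pq.1 : ℝ) / pq.2 ≠ 0 := by
      simpa using (hx.sub_ratCast ((pq.1 : ℚ) / pq.2)).ne_zero
    exact tendsto_one_div_atTop_nhds_zero_nat.eventually_lt_const (abs_pos.2 hne)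
  obtain ⟨n, hn, hn0⟩ := (hev.and (Filter.eventually_gt_atTop 0)).exists
  obtain ⟨a, b, c, d, hb, hd, hdet, ha, hc, hbd⟩ := exists_farey_interval hx n
  obtain ⟨p, q, hq, hpq, hgood, hclose⟩ := exists_sqrt_five_mul_lt_one hb hd hdet ha hc
  have hq' : (0 : ℝ) < q := by exact_mod_cast hq
  have hn' : (0 : ℝ) < n := by exact_mod_cast hn0
  have hle : (n : ℝ) ≤ b * d := by
    have : (n : ℤ) ≤ b * d := by nlinarith
    exact_mod_cast this
  refine (hn (p, q) ⟨hq, hpq, ?_⟩).not_gt ?_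
  · rw [show 1 / (√5 * (q : ℝ) ^ 2) = 1 / (√5 * q) / q by field_simp, abs_sub_div_lt_div_iff hq',
      lt_div_iff₀ (by positivity)]
    linarith
  · rw [show 1 / (n : ℝ) = q / n / q by field_simp, abs_sub_div_lt_div_iff hq', lt_div_iff₀ hn']
    have := mul_le_mul_of_nonneg_right hle (abs_nonneg (q * x - p))
    linarith

/-- The norm form of `ℤ[φ]` is at least `1` in absolute value at nonzero vectors. -/
theorem one_le_abs_mul_goldenRatio_sub (p : ℤ) {q : ℤ} (hq : q ≠ 0) :
    1 ≤ |(q : ℝ) * Real.goldenRatio - p| * |(q : ℝ) * Real.goldenConj - p| := by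
  have h : ((q : ℝ) * Real.goldenRatio - p) * (q * Real.goldenConj - p)
      = ((p ^ 2 - p * q - q ^ 2 : ℤ) : ℝ) := by
    push_cast
    linear_combination (q : ℝ) ^ 2 * Real.goldenRatio_mul_goldenConj -
      (p * q : ℝ) * Real.goldenRatio_add_goldenConj
  have hne := mul_ne_zero (Real.goldenRatio_irrational.intCast_mul_sub_intCast_ne_zero p hq)
    (Real.goldenConj_irrational.intCast_mul_sub_intCast_ne_zero p hq)
  rw [← abs_mul]
  rw [h] at hne ⊢
  exact_mod_cast Int.one_le_abs (by exact_mod_cast hne)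

theorem finite_abs_goldenRatio_sub_div_lt {c : ℝ} (hc : c < 1 / √5) :
    {pq : ℤ × ℤ | 1 ≤ pq.2 ∧ IsCoprime pq.1 pq.2 ∧
      |Real.goldenRatio - (pq.1 : ℝ) / (pq.2 : ℝ)| < c / (pq.2 : ℝ) ^ 2}.Finite := by
  have hc5 : 0 < 1 - c * √5 := by
    rw [lt_div_iff₀ (by positivity)] at hc
    linarith
  obtain ⟨M, hM⟩ := exists_nat_gt (c ^ 2 / (1 - c * √5))
  obtain ⟨K, hK⟩ := exists_nat_gt (c + M * 2)
  refine ((Set.finite_Icc (-(K : ℤ)) K).prod (Set.finite_Icc (1 : ℤ) M)).subset ?_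
  rintro ⟨p, q⟩ ⟨hq, -, h⟩
  dsimp only at hq h
  have hq' : (1 : ℝ) ≤ q := by exact_mod_cast hq
  have hq0 : (0 : ℝ) < q := by linarith
  rw [show c / (q : ℝ) ^ 2 = c / q / q by field_simp, abs_sub_div_lt_div_iff hq0,
    lt_div_iff₀ hq0] at h
  have hnorm := one_le_abs_mul_goldenRatio_sub p (q := q) (by lia)
  have hconj : |(q : ℝ) * Real.goldenConj - p| ≤ |(q : ℝ) * Real.goldenRatio - p| + q * √5 := by
    have h5 : (q : ℝ) * Real.goldenConj - p = (q * Real.goldenRatio - p) - q * √5 := by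
      linear_combination -(q : ℝ) * Real.goldenRatio_sub_goldenConj
    rw [h5]
    refine (abs_sub _ _).trans_eq ?_
    rw [abs_of_nonneg (show 0 ≤ (q : ℝ) * √5 by positivity)]
  set δ := |(q : ℝ) * Real.goldenRatio - p| with hδ
  have hδ0 : 0 ≤ δ := abs_nonneg _
  have hqM : (q : ℝ) < M := by
    have h₁ : 1 ≤ δ * (δ + q * √5) := hnorm.trans (mul_le_mul_of_nonneg_left hconj hδ0)
    have h₂ : (δ * q) * √5 ≤ c * √5 := mul_le_mul_of_nonneg_right h.le (Real.sqrt_nonneg 5)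
    have h₃ : (1 - c * √5) ≤ δ ^ 2 := by linarith
    have h₄ : (δ * q) ^ 2 ≤ c ^ 2 := pow_le_pow_left₀ (by positivity) h.le 2
    have h₅ : (q : ℝ) ^ 2 ≤ c ^ 2 / (1 - c * √5) := by
      rw [le_div_iff₀ hc5]
      nlinarith
    nlinarith
  have hpK : |(p : ℝ)| < K := by
    have h₁ : δ < c := by nlinarith
    have h₂ : (q : ℝ) * Real.goldenRatio ≤ M * 2 :=
      mul_le_mul hqM.le Real.goldenRatio_lt_two.le Real.goldenRatio_pos.le (by positivity)
    have h₃ : 0 < (q : ℝ) * Real.goldenRatio := mul_pos hq0 Real.goldenRatio_pos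
    have h₄ := abs_le.1 hδ.ge
    rw [abs_lt]
    constructor <;> linarith
  have hpK' : |p| < K := by exact_mod_cast hpK
  have hqM' : q < M := by exact_mod_cast hqM
  exact ⟨⟨(abs_lt.1 hpK').1.le, (abs_lt.1 hpK').2.le⟩, hq, hqM'.le⟩

/-- **Hurwitz's theorem.** Every irrational `x` admits infinitely many reduced rationals `p/q`
(`q ≥ 1`, `gcd(p,q)=1`) with `|x - p/q| < 1/(√5 q²)`; moreover `1/√5` is optimal: for the
golden ratio `(1+√5)/2` and any `c < 1/√5` the inequality `|x - p/q| < c/q²` has only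
finitely many reduced rational solutions. -/
theorem hurwitz :
    (∀ x : ℝ, Irrational x →
      {pq : ℤ × ℤ | 1 ≤ pq.2 ∧ IsCoprime pq.1 pq.2 ∧
        |x - (pq.1 : ℝ) / (pq.2 : ℝ)| < 1 / (Real.sqrt 5 * (pq.2 : ℝ) ^ 2)}.Infinite) ∧
    (∀ c : ℝ, c < 1 / Real.sqrt 5 →
      {pq : ℤ × ℤ | 1 ≤ pq.2 ∧ IsCoprime pq.1 pq.2 ∧
        |(1 + Real.sqrt 5) / 2 - (pq.1 : ℝ) / (pq.2 : ℝ)| < c / (pq.2 : ℝ) ^ 2}.Finite) :=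
  ⟨fun _ hx ↦ infinite_abs_sub_div_lt_one_div_sqrt_five hx,
    fun _ hc ↦ finite_abs_goldenRatio_sub_div_lt hc⟩
end

section
/- (Khintchine) Let ψ : ℕ → ℝ_{>0} be a non-increasing function. If the sum Σ_{m=1}^∞ m·ψ(m) diverges, then for Lebesgue-almost every real number x the inequality |x − p/q| < ψ(q) has infinitely many solutions with (p,q) ∈ ℤ × ℕ; if the sum Σ_{m=1}^∞ m·ψ(m) converges, then for Lebesgue-almost every real number x this inequality has only finitely many solutions. -/
open MeasureTheory

theorem Nat.two_mul_sum_totient_Ioc_le (m : ℕ) :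
    2 * ∑ q ∈ Finset.Ioc 0 m, q.totient ≤ m ^ 2 + 1 := by
  induction m with
  | zero => simp
  | succ m ih =>
    rw [Finset.sum_Ioc_succ_top (Nat.zero_le m)]
    rcases Nat.eq_zero_or_pos m with rfl | hm
    · simp
    · have := Nat.totient_lt (m + 1) (by lia)
      nlinarith

theorem Nat.sum_Ioc_sum_totient_Ioc_div (N : ℕ) :
    2 * ∑ k ∈ Finset.Ioc 0 N, ∑ q ∈ Finset.Ioc 0 (N / k), q.totient = N * (N + 1) := by
  let f : ArithmeticFunction ℕ := ⟨Nat.totient, Nat.totient_zero⟩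
  have h := ArithmeticFunction.sum_Ioc_mul_eq_sum_sum ArithmeticFunction.zeta f N
  have h2 : ∀ n : ℕ, (ArithmeticFunction.zeta * f) n = n := by
    intro n
    rw [ArithmeticFunction.zeta_mul_apply]
    exact Nat.sum_totient n
  have h3 : ∑ k ∈ Finset.Ioc 0 N, ∑ q ∈ Finset.Ioc 0 (N / k), q.totient
      = ∑ n ∈ Finset.Ioc 0 N, n := by
    rw [← Finset.sum_congr rfl fun n _ => h2 n, h]
    refine Finset.sum_congr rfl fun k hk => ?_
    rw [ArithmeticFunction.zeta_apply_ne (Finset.mem_Ioc.1 hk).1.ne', one_mul]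
    rfl
  rw [h3]
  clear h h2 h3 f
  induction N with
  | zero => simp
  | succ m ih =>
    rw [Finset.sum_Ioc_succ_top (Nat.zero_le m), mul_add, ih]
    ring

theorem Nat.sq_div_six_le_sum_totient_Ioc (N : ℕ) :
    (N : ℝ) ^ 2 / 6 ≤ ∑ q ∈ Finset.Ioc 0 N, (q.totient : ℝ) := by
  rcases Nat.eq_zero_or_pos N with rfl | hN
  · simp
  have hinv : ∀ M : ℕ, 1 ≤ M →
      ∑ k ∈ Finset.Ioc 1 M, (1 / (k : ℝ) ^ 2) ≤ 2 / 3 - 1 / ((M : ℝ) + 1 / 2) := by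
    intro M hM
    induction M, hM using Nat.le_induction with
    | base => norm_num
    | succ m hm ih =>
      rw [Finset.sum_Ioc_succ_top hm]
      have : 1 / ((m + 1 : ℕ) : ℝ) ^ 2 ≤ 1 / (m + 1 / 2 : ℝ) - 1 / ((m + 1 : ℕ) + 1 / 2 : ℝ) := by
        push_cast
        rw [div_sub_div _ _ (by positivity) (by positivity),
          div_le_div_iff₀ (by positivity) (by positivity)]
        nlinarith
      linarith
  have htail : ∑ k ∈ Finset.Ioc 1 N, ∑ q ∈ Finset.Ioc 0 (N / k), (q.totient : ℝ)
      ≤ ∑ k ∈ Finset.Ioc 1 N, ((N : ℝ) ^ 2 / 2 * (1 / (k : ℝ) ^ 2) + 1 / 2) := by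
    refine Finset.sum_le_sum fun k hk => ?_
    have h1 : 2 * ∑ q ∈ Finset.Ioc 0 (N / k), (q.totient : ℝ) ≤ ((N / k : ℕ) : ℝ) ^ 2 + 1 := by
      exact_mod_cast Nat.two_mul_sum_totient_Ioc_le (N / k)
    have h2 : ((N / k : ℕ) : ℝ) ^ 2 ≤ ((N : ℝ) / k) ^ 2 :=
      pow_le_pow_left₀ (Nat.cast_nonneg _) Nat.cast_div_le 2
    rw [div_pow] at h2
    have h3 : (N : ℝ) ^ 2 / 2 * (1 / (k : ℝ) ^ 2) = (N : ℝ) ^ 2 / (k : ℝ) ^ 2 / 2 := by ring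
    linarith
  have htot : 2 * ∑ k ∈ Finset.Ioc 0 N, ∑ q ∈ Finset.Ioc 0 (N / k), (q.totient : ℝ)
      = N * (N + 1) := by
    exact_mod_cast Nat.sum_Ioc_sum_totient_Ioc_div N
  rw [← Finset.sum_Ioc_consecutive _ (Nat.zero_le 1) hN] at htot
  rw [Finset.sum_add_distrib, ← Finset.mul_sum] at htail
  have hN' : (1 : ℝ) ≤ N := by exact_mod_cast hN
  have h4 := mul_le_mul_of_nonneg_left (hinv N hN) (by positivity : (0 : ℝ) ≤ (N : ℝ) ^ 2 / 2)
  have h5 : 0 ≤ (N : ℝ) ^ 2 / 2 * (1 / (N + 1 / 2)) := by positivity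
  simp [Nat.cast_sub hN] at htot htail
  simp at h4 h5
  nlinarith

/-- Partial sums of `a` stay nonnegative after weighting by an antitone nonnegative sequence. -/
theorem Antitone.sum_mul_nonneg {ψ a : ℕ → ℝ} (hψ : Antitone ψ) (hψ0 : ∀ n, 0 ≤ ψ n)
    (ha : ∀ n, 0 ≤ ∑ q ∈ Finset.Ioc 0 n, a q) (n : ℕ) :
    0 ≤ ∑ q ∈ Finset.Ioc 0 n, a q * ψ q := by
  suffices h : (∑ q ∈ Finset.Ioc 0 n, a q) * ψ n ≤ ∑ q ∈ Finset.Ioc 0 n, a q * ψ q from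
    (mul_nonneg (ha n) (hψ0 n)).trans h
  induction n with
  | zero => simp
  | succ n ih =>
    rw [Finset.sum_Ioc_succ_top (Nat.zero_le n), Finset.sum_Ioc_succ_top (Nat.zero_le n), add_mul]
    have := mul_le_mul_of_nonneg_left (hψ (Nat.le_succ n)) (ha n)
    simp only [Nat.succ_eq_add_one] at this
    linarith

theorem Antitone.sum_mul_le_sum_totient_mul {ψ : ℕ → ℝ} (hψ : Antitone ψ) (hψ0 : ∀ n, 0 ≤ ψ n)
    (n : ℕ) :
    (∑ q ∈ Finset.Ioc 0 n, (q : ℝ) * ψ q) / 6 ≤ ∑ q ∈ Finset.Ioc 0 n, (q.totient : ℝ) * ψ q := by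
  have hid : ∀ n : ℕ, ∑ q ∈ Finset.Ioc 0 n, (q : ℝ) = n * (n + 1) / 2 := by
    intro n
    induction n with
    | zero => simp
    | succ n ih =>
      rw [Finset.sum_Ioc_succ_top (Nat.zero_le n), ih]
      push_cast
      ring
  have h := hψ.sum_mul_nonneg (a := fun q => (q.totient : ℝ) - q / 6) hψ0 (fun m => by
    have h1 := Nat.sq_div_six_le_sum_totient_Ioc m
    rw [Finset.sum_sub_distrib, ← Finset.sum_div, hid]
    rcases Nat.eq_zero_or_pos m with rfl | hm
    · simp
    have : (1 : ℝ) ≤ m := by exact_mod_cast hm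
    nlinarith) n
  simp only [sub_mul, Finset.sum_sub_distrib] at h
  rw [Finset.sum_div]
  have : ∀ q : ℕ, (q : ℝ) / 6 * ψ q = (q : ℝ) * ψ q / 6 := fun q => by ring
  simp only [this] at h
  linarith

/-- The **Chung–Erdős inequality**. -/
theorem MeasureTheory.sq_sum_measureReal_le {α ι : Type*} [MeasurableSpace α] {μ : Measure α}
    (s : Finset ι) {A : ι → Set α} (hA : ∀ i ∈ s, MeasurableSet (A i))
    (hfin : ∀ i ∈ s, μ (A i) ≠ ⊤) :
    (∑ i ∈ s, μ.real (A i)) ^ 2 ≤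
      μ.real (⋃ i ∈ s, A i) * ∑ i ∈ s, ∑ j ∈ s, μ.real (A i ∩ A j) := by
  classical
  set U := ⋃ i ∈ s, A i
  have hUm : MeasurableSet U := Finset.measurableSet_biUnion s hA
  have hUfin : μ U ≠ ⊤ := (measure_biUnion_lt_top s.finite_toSet fun i hi => (hfin i hi).lt_top).ne
  have hint : ∀ {B : Set α}, MeasurableSet B → μ B ≠ ⊤ →
      Integrable (B.indicator (fun _ => (1 : ℝ))) μ := fun hB hB' =>
    (integrable_indicator_iff hB).2 (integrableOn_const hB')
  have hfin2 : ∀ i ∈ s, ∀ j, μ (A i ∩ A j) ≠ ⊤ := fun i hi j =>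
    measure_ne_top_of_subset Set.inter_subset_left (hfin i hi)
  have hpt : ∀ t : ℝ, ∀ x,
      (∑ i ∈ s, ∑ j ∈ s, (A i ∩ A j).indicator (fun _ => (1 : ℝ)) x)
        - 2 * t * ∑ i ∈ s, (A i).indicator (fun _ => (1 : ℝ)) x
        + t ^ 2 * U.indicator (fun _ => (1 : ℝ)) x
      = (∑ i ∈ s, (A i).indicator (fun _ => (1 : ℝ)) x
        - t * U.indicator (fun _ => (1 : ℝ)) x) ^ 2 := by
    intro t x
    have h1 : ∑ i ∈ s, ∑ j ∈ s, (A i ∩ A j).indicator (fun _ => (1 : ℝ)) x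
        = (∑ i ∈ s, (A i).indicator (fun _ => (1 : ℝ)) x) ^ 2 := by
      rw [sq, Finset.sum_mul_sum]
      refine Finset.sum_congr rfl fun i _ => Finset.sum_congr rfl fun j _ => ?_
      by_cases hi : x ∈ A i <;> by_cases hj : x ∈ A j <;> simp [hi, hj]
    rw [h1]
    by_cases hx : x ∈ U
    · simp only [Set.indicator_of_mem hx]; ring
    · have : ∑ i ∈ s, (A i).indicator (fun _ => (1 : ℝ)) x = 0 :=
        Finset.sum_eq_zero fun i hi => Set.indicator_of_notMem
          (fun h => hx (Set.mem_biUnion (Finset.mem_coe.2 hi) h)) _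
      simp [Set.indicator_of_notMem hx, this]
  have hquad : ∀ t : ℝ, 0 ≤ μ.real U * (t * t) + (-2 * ∑ i ∈ s, μ.real (A i)) * t
      + ∑ i ∈ s, ∑ j ∈ s, μ.real (A i ∩ A j) := by
    intro t
    have h0 := integral_nonneg (μ := μ) (f := fun x => (∑ i ∈ s, (A i).indicator (fun _ => (1 : ℝ)) x
      - t * U.indicator (fun _ => (1 : ℝ)) x) ^ 2) fun x => sq_nonneg _
    simp_rw [← hpt t] at h0
    have i1 : Integrable (fun x => ∑ i ∈ s, (A i).indicator (fun _ => (1 : ℝ)) x) μ :=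
      integrable_finsetSum _ fun i hi => hint (hA i hi) (hfin i hi)
    have i3 : ∀ i ∈ s, Integrable
        (fun x => ∑ j ∈ s, (A i ∩ A j).indicator (fun _ => (1 : ℝ)) x) μ := fun i hi =>
      integrable_finsetSum _ fun j hj => hint ((hA i hi).inter (hA j hj)) (hfin2 i hi j)
    have i2 : Integrable (fun x => ∑ i ∈ s, ∑ j ∈ s, (A i ∩ A j).indicator (fun _ => (1 : ℝ)) x) μ :=
      integrable_finsetSum _ i3
    have i4 : Integrable (fun x => (∑ i ∈ s, ∑ j ∈ s, (A i ∩ A j).indicator (fun _ => (1 : ℝ)) x)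
        - 2 * t * ∑ i ∈ s, (A i).indicator (fun _ => (1 : ℝ)) x) μ := i2.sub (i1.const_mul _)
    rw [integral_add i4 ((hint hUm hUfin).const_mul _),
      integral_sub i2 (i1.const_mul _), integral_const_mul, integral_const_mul,
      integral_finsetSum _ i3,
      integral_finsetSum _ fun i hi => hint (hA i hi) (hfin i hi)] at h0
    have e1 : ∑ i ∈ s, ∫ x, (A i).indicator (fun _ => (1 : ℝ)) x ∂μ = ∑ i ∈ s, μ.real (A i) :=
      Finset.sum_congr rfl fun i hi => integral_indicator_one (hA i hi)
    have e2 : ∑ i ∈ s, ∫ x, ∑ j ∈ s, (A i ∩ A j).indicator (fun _ => (1 : ℝ)) x ∂μ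
        = ∑ i ∈ s, ∑ j ∈ s, μ.real (A i ∩ A j) := by
      refine Finset.sum_congr rfl fun i hi => ?_
      rw [integral_finsetSum _ fun j hj => hint ((hA i hi).inter (hA j hj)) (hfin2 i hi j)]
      exact Finset.sum_congr rfl fun j hj => integral_indicator_one ((hA i hi).inter (hA j hj))
    have e3 : ∫ x, U.indicator (fun _ => (1 : ℝ)) x ∂μ = μ.real U := integral_indicator_one hUm
    rw [e1, e2, e3] at h0
    linarith
  have := discrim_le_zero hquad
  rw [discrim] at this
  nlinarith

/-- Distinct fractions `p / q ≠ p' / r` in `[0, 1)` whose cross difference is below `T` come in at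
most `2 * T` pairs. -/
theorem Nat.card_filter_cross_mul_lt_le {q r : ℕ} (hq : 0 < q) (T : ℝ) (hT : 0 ≤ T) :
    ((((Finset.range q ×ˢ Finset.range r).filter fun x : ℕ × ℕ =>
      x.1 * r ≠ x.2 * q ∧ |(x.1 : ℝ) * r - x.2 * q| < T).card : ℕ) : ℝ) ≤ 2 * T := by
  obtain ⟨d, hd⟩ : ∃ d, d = Nat.gcd q r := ⟨_, rfl⟩
  have hd0 : 0 < d := hd ▸ Nat.gcd_pos_of_pos_left r hq
  obtain ⟨a, b, hab, ha, hb⟩ := Nat.exists_coprime q r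
  rw [← hd] at ha hb
  have ha0 : 0 < a := Nat.pos_of_mul_pos_right (ha ▸ hq)
  have hd0' : (0 : ℝ) < d := by exact_mod_cast hd0
  set K : ℕ := ⌊T / d⌋₊
  have hcard := Finset.card_le_card_of_injOn
    (s := (Finset.range q ×ˢ Finset.range r).filter fun x : ℕ × ℕ =>
      x.1 * r ≠ x.2 * q ∧ |(x.1 : ℝ) * r - x.2 * q| < T)
    (t := (Finset.Icc (-(K : ℤ)) K).erase 0 ×ˢ Finset.range d)
    (fun x => ((x.1 * b - x.2 * a : ℤ), x.1 / a)) ?_ ?_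
  · have hc : ((Finset.Icc (-(K : ℤ)) K).erase 0 ×ˢ Finset.range d).card = 2 * K * d := by
      rw [Finset.card_product, Finset.card_erase_of_mem (by simp), Int.card_Icc, Finset.card_range]
      congr 1
      lia
    rw [hc] at hcard
    calc _ ≤ ((2 * K * d : ℕ) : ℝ) := by exact_mod_cast hcard
      _ = 2 * (K * d) := by push_cast; ring
      _ ≤ 2 * (T / d * d) := by
        have := Nat.floor_le (div_nonneg hT hd0'.le)
        gcongr
      _ = 2 * T := by rw [div_mul_cancel₀ _ hd0'.ne']
  · rintro ⟨p, p'⟩ hx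
    simp only [Finset.coe_filter, Finset.mem_product, Finset.mem_range, Set.mem_ofPred_eq] at hx
    obtain ⟨⟨hp, hp'⟩, hne, hlt⟩ := hx
    have hcast : (p : ℝ) * r - p' * q = d * ((p * b - p' * a : ℤ) : ℝ) := by
      rw [ha, hb]; push_cast; ring
    rw [hcast, abs_mul, abs_of_pos hd0', mul_comm, ← lt_div_iff₀ hd0'] at hlt
    have habs : (p * b - p' * a : ℤ).natAbs ≤ K := by
      refine Nat.le_floor ?_
      rw [Nat.cast_natAbs, Int.cast_abs]
      exact hlt.le
    have hv : (p * b - p' * a : ℤ) ≠ 0 := by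
      intro h
      apply hne
      have h' : p * b = p' * a := by exact_mod_cast sub_eq_zero.1 h
      rw [ha, hb, ← mul_assoc, ← mul_assoc, h']
    simp only [Finset.coe_product, Set.mem_prod, Finset.mem_coe, Finset.mem_erase, Finset.mem_Icc,
      Finset.mem_range]
    refine ⟨⟨hv, by lia, by lia⟩, ?_⟩
    rw [Nat.div_lt_iff_lt_mul ha0, mul_comm, mul_comm d a, mul_comm a d] at *
    lia
  · rintro ⟨p, p'⟩ - ⟨s, s'⟩ - h
    simp only [Prod.mk.injEq] at h
    obtain ⟨h1, h2⟩ := h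
    have hdvd : (a : ℤ) ∣ (p - s) := by
      refine (Nat.isCoprime_iff_coprime.2 hab).dvd_of_dvd_mul_right ⟨p' - s', ?_⟩
      linear_combination h1
    have hmod : s % a = p % a := Nat.modEq_iff_dvd.2 hdvd
    have hps : p = s := by
      rw [← Nat.div_add_mod p a, ← Nat.div_add_mod s a, h2, hmod]
    subst hps
    have ha0' : (a : ℤ) ≠ 0 := by exact_mod_cast ha0.ne'
    have : (p' : ℤ) = s' := mul_right_cancel₀ ha0' (by linear_combination -h1)
    simp only [Prod.mk.injEq, true_and]
    exact_mod_cast this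

/-- Numerators in `[0, q)` of the reduced fractions with denominator `q`. -/
def reducedNumerators (q : ℕ) : Finset ℕ :=
  (Finset.range q).filter q.Coprime

theorem card_reducedNumerators (q : ℕ) : (reducedNumerators q).card = q.totient := rfl

theorem Real.volume_real_ball_inter_ball_le {x y δ ε : ℝ} (hδ : 0 ≤ δ) (hε : 0 ≤ ε) :
    volume.real (Metric.ball x δ ∩ Metric.ball y ε) ≤
      if |x - y| < δ + ε then 2 * min δ ε else 0 := by
  split_ifs with h
  · rw [mul_min_of_nonneg _ _ zero_le_two]
    refine le_min ?_ ?_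
    · rw [← Real.volume_real_ball (a := x) hδ]
      exact measureReal_mono Set.inter_subset_left measure_ball_lt_top.ne
    · rw [← Real.volume_real_ball (a := y) hε]
      exact measureReal_mono Set.inter_subset_right measure_ball_lt_top.ne
  · rw [Set.disjoint_iff_inter_eq_empty.1 (Metric.ball_disjoint_ball (by
      rw [Real.dist_eq]; exact not_lt.1 h))]
    simp

theorem sum_reducedNumerators_volume_inter_le {q r : ℕ} (hq : 0 < q) (hr : 0 < r) {δ ε : ℝ}
    (hδ : 0 ≤ δ) (hε : 0 ≤ ε) :
    ∑ p ∈ reducedNumerators q, ∑ p' ∈ reducedNumerators r,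
      (if p * r ≠ p' * q then
        volume.real (Metric.ball ((p : ℝ) / q) δ ∩ Metric.ball ((p' : ℝ) / r) ε) else 0) ≤
      8 * (q * δ) * (r * ε) := by
  have hq' : (0 : ℝ) < q := by exact_mod_cast hq
  have hr' : (0 : ℝ) < r := by exact_mod_cast hr
  set T : ℝ := (δ + ε) * (q * r)
  have hT : 0 ≤ T := by positivity
  have hterm : ∀ p p' : ℕ, (if p * r ≠ p' * q then
        volume.real (Metric.ball ((p : ℝ) / q) δ ∩ Metric.ball ((p' : ℝ) / r) ε) else 0) ≤
      if p * r ≠ p' * q ∧ |(p : ℝ) * r - p' * q| < T then 2 * min δ ε else 0 := by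
    intro p p'
    by_cases hne : p * r ≠ p' * q
    · simp only [if_pos hne]
      refine (Real.volume_real_ball_inter_ball_le hδ hε).trans_eq ?_
      have : |(p : ℝ) / q - p' / r| < δ + ε ↔ |(p : ℝ) * r - p' * q| < T := by
        rw [div_sub_div _ _ hq'.ne' hr'.ne', abs_div, abs_of_pos (mul_pos hq' hr'),
          div_lt_iff₀ (mul_pos hq' hr'), mul_comm (q : ℝ) p']
      simp only [this, hne, ne_eq, not_false_eq_true, true_and]
    · simp [hne]
  have hmin : 0 ≤ min δ ε := le_min hδ hε
  calc _ ≤ ∑ p ∈ Finset.range q, ∑ p' ∈ Finset.range r,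
        (if p * r ≠ p' * q ∧ |(p : ℝ) * r - p' * q| < T then 2 * min δ ε else 0) := by
        have hnn : ∀ p p' : ℕ, 0 ≤
            (if p * r ≠ p' * q ∧ |(p : ℝ) * r - p' * q| < T then 2 * min δ ε else 0) := by
          intro p p'; split_ifs <;> positivity
        refine (Finset.sum_le_sum fun p _ => (Finset.sum_le_sum fun p' _ => hterm p p').trans
          (Finset.sum_le_sum_of_subset_of_nonneg (Finset.filter_subset _ _)
            fun p' _ _ => hnn p p')).trans
          (Finset.sum_le_sum_of_subset_of_nonneg (Finset.filter_subset _ _)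
            fun p _ _ => Finset.sum_nonneg fun p' _ => hnn p p')
    _ = (((Finset.range q ×ˢ Finset.range r).filter fun x : ℕ × ℕ =>
          x.1 * r ≠ x.2 * q ∧ |(x.1 : ℝ) * r - x.2 * q| < T).card : ℝ) * (2 * min δ ε) := by
        rw [← Finset.sum_product', ← Finset.sum_filter, Finset.sum_const, nsmul_eq_mul]
    _ ≤ 2 * T * (2 * min δ ε) := by
        have := Nat.card_filter_cross_mul_lt_le (r := r) hq T hT
        gcongr
    _ = 4 * (min δ ε * δ + min δ ε * ε) * (q * r) := by ring
    _ ≤ 4 * (ε * δ + δ * ε) * (q * r) := by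
        gcongr
        · exact min_le_right _ _
        · exact min_le_left _ _
    _ = 8 * (q * δ) * (r * ε) := by ring

theorem Nat.Coprime.eq_and_eq_of_cross_mul_eq {p q p' r : ℕ} (hq : 0 < q)
    (h : q.Coprime p) (h' : r.Coprime p') (he : p * r = p' * q) : q = r ∧ p = p' := by
  have h1 : q = r := Nat.dvd_antisymm (h.dvd_of_dvd_mul_left ⟨p', by rw [he, mul_comm]⟩)
    (h'.dvd_of_dvd_mul_left ⟨p, by rw [← he, mul_comm]⟩)
  subst h1
  exact ⟨rfl, Nat.eq_of_mul_eq_mul_right hq he⟩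

/-- The points within `ψ q` of a reduced fraction in `[0, 1)` with denominator `q ∈ (M, N]`. -/
def reducedNeighbourhood (ψ : ℕ → ℝ) (M N : ℕ) : Set ℝ :=
  ⋃ i ∈ (Finset.Ioc M N).sigma reducedNumerators, Metric.ball ((i.2 : ℝ) / i.1) (ψ i.1)

theorem sq_sum_totient_mul_le {ψ : ℕ → ℝ} (hψ : ∀ n, 0 ≤ ψ n) (M N : ℕ) :
    (2 * ∑ q ∈ Finset.Ioc M N, (q.totient : ℝ) * ψ q) ^ 2 ≤
      volume.real (reducedNeighbourhood ψ M N) *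
        (2 * ∑ q ∈ Finset.Ioc M N, (q.totient : ℝ) * ψ q +
          8 * (∑ q ∈ Finset.Ioc M N, (q : ℝ) * ψ q) ^ 2) := by
  set s := (Finset.Ioc M N).sigma reducedNumerators
  let A : (Σ _ : ℕ, ℕ) → Set ℝ := fun i => Metric.ball ((i.2 : ℝ) / i.1) (ψ i.1)
  have hvol : ∀ i, volume.real (A i) = 2 * ψ i.1 := fun i => Real.volume_real_ball (hψ i.1)
  have hsum : ∑ i ∈ s, volume.real (A i) = 2 * ∑ q ∈ Finset.Ioc M N, (q.totient : ℝ) * ψ q := by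
    simp_rw [hvol]
    rw [Finset.sum_sigma, Finset.mul_sum]
    refine Finset.sum_congr rfl fun q _ => ?_
    simp only
    rw [Finset.sum_const, card_reducedNumerators, nsmul_eq_mul]
    ring
  have hCE := MeasureTheory.sq_sum_measureReal_le (μ := volume) s (A := A)
    (fun i _ => Metric.isOpen_ball.measurableSet) (fun i _ => measure_ball_lt_top.ne)
  rw [hsum] at hCE
  refine hCE.trans (mul_le_mul_of_nonneg_left ?_ measureReal_nonneg)
  have hsplit : ∀ i ∈ s, ∀ j ∈ s, volume.real (A i ∩ A j) ≤
      (if i = j then volume.real (A i) else 0) +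
        (if i.2 * j.1 ≠ j.2 * i.1 then volume.real (A i ∩ A j) else 0) := by
    rintro ⟨q, p⟩ hi ⟨r, p'⟩ hj
    simp only [s, reducedNumerators, Finset.mem_sigma, Finset.mem_Ioc, Finset.mem_filter,
      Finset.mem_range] at hi hj
    by_cases hne : p * r ≠ p' * q
    · simp only [if_pos hne]
      refine le_add_of_nonneg_left ?_
      split_ifs <;> simp [measureReal_nonneg]
    · obtain ⟨rfl, rfl⟩ := Nat.Coprime.eq_and_eq_of_cross_mul_eq (by lia) hi.2.2 hj.2.2
        (not_not.1 hne)
      simp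
  refine (Finset.sum_le_sum fun i hi => Finset.sum_le_sum fun j hj => hsplit i hi j hj).trans ?_
  simp_rw [Finset.sum_add_distrib]
  refine add_le_add ?_ ?_
  · rw [← hsum]
    refine Finset.sum_le_sum fun i hi => ?_
    rw [Finset.sum_ite_eq, if_pos hi]
  · rw [Finset.sum_sigma]
    simp_rw [s, Finset.sum_sigma]
    rw [sq, Finset.sum_mul_sum, Finset.mul_sum]
    refine Finset.sum_le_sum fun q hq => ?_
    rw [Finset.sum_comm, Finset.mul_sum]
    refine Finset.sum_le_sum fun r hr => ?_
    have hq0 : 0 < q := by have := Finset.mem_Ioc.1 hq; lia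
    have hr0 : 0 < r := by have := Finset.mem_Ioc.1 hr; lia
    refine (sum_reducedNumerators_volume_inter_le hq0 hr0 (hψ q) (hψ r)).trans_eq ?_
    ring

theorem exists_le_volume_reducedNeighbourhood {ψ : ℕ → ℝ} (hψ0 : ∀ n, 0 ≤ ψ n) (hψ : Antitone ψ)
    (hdiv : ¬ Summable fun m : ℕ => (m : ℝ) * ψ m) (M : ℕ) :
    ∃ N, 1 / 360 ≤ volume.real (reducedNeighbourhood ψ M N) := by
  let D : ℕ → ℝ := fun n => ∑ q ∈ Finset.Ioc 0 n, (q : ℝ) * ψ q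
  have hnn : ∀ q : ℕ, 0 ≤ (q : ℝ) * ψ q := fun q => mul_nonneg (Nat.cast_nonneg q) (hψ0 q)
  have hD : Filter.Tendsto D Filter.atTop Filter.atTop := by
    have h := (not_summable_iff_tendsto_nat_atTop_of_nonneg hnn).1 hdiv
    refine (h.comp (Filter.tendsto_add_atTop_nat 1)).congr fun n => ?_
    rw [Function.comp_apply, Finset.range_eq_Ico, Finset.sum_eq_sum_Ico_succ_bot (Nat.succ_pos n)]
    simp only [D, Nat.cast_zero, zero_mul, zero_add]
    rfl
  obtain ⟨N, ⟨h1, h2⟩, hMN⟩ := (((hD.eventually_ge_atTop 1).and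
    (hD.eventually_ge_atTop (12 * D M))).and (Filter.eventually_ge_atTop M)).exists
  refine ⟨N, ?_⟩
  have key := sq_sum_totient_mul_le hψ0 M N
  have hφD : ∀ n, ∑ q ∈ Finset.Ioc 0 n, (q.totient : ℝ) * ψ q ≤ D n := fun n =>
    Finset.sum_le_sum fun q _ => mul_le_mul_of_nonneg_right
      (by exact_mod_cast Nat.totient_le q) (hψ0 q)
  have hlow := hψ.sum_mul_le_sum_totient_mul hψ0 N
  have hsplit := Finset.sum_Ioc_consecutive (fun q : ℕ => (q.totient : ℝ) * ψ q) (Nat.zero_le M) hMN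
  have hsplitD := Finset.sum_Ioc_consecutive (fun q : ℕ => (q : ℝ) * ψ q) (Nat.zero_le M) hMN
  have hM0 : 0 ≤ D M := Finset.sum_nonneg fun q _ => hnn q
  have hM0' : 0 ≤ ∑ q ∈ Finset.Ioc 0 M, (q.totient : ℝ) * ψ q :=
    Finset.sum_nonneg fun q _ => mul_nonneg (Nat.cast_nonneg _) (hψ0 q)
  have hMN0 : 0 ≤ ∑ q ∈ Finset.Ioc M N, (q : ℝ) * ψ q := Finset.sum_nonneg fun q _ => hnn q
  have hφM := hφD M
  have hφN := hφD N
  change D N / 6 ≤ _ at hlow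
  change D M + _ = D N at hsplitD
  set S := ∑ q ∈ Finset.Ioc M N, (q.totient : ℝ) * ψ q
  set E := ∑ q ∈ Finset.Ioc M N, (q : ℝ) * ψ q
  set v := volume.real (reducedNeighbourhood ψ M N)
  have hv : 0 ≤ v := measureReal_nonneg
  have hS : D N / 6 ≤ 2 * S := by linarith
  have hsq : (D N / 6) ^ 2 ≤ (2 * S) ^ 2 := pow_le_pow_left₀ (by positivity) hS 2
  have hE : E ^ 2 ≤ D N ^ 2 := pow_le_pow_left₀ hMN0 (by linarith) 2
  have hup : 2 * S + 8 * E ^ 2 ≤ 10 * D N ^ 2 := by nlinarith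
  have hfin : (D N / 6) ^ 2 ≤ v * (10 * D N ^ 2) :=
    hsq.trans (key.trans (mul_le_mul_of_nonneg_left hup hv))
  have hpos : 0 < D N ^ 2 := by positivity
  by_contra! hlt
  nlinarith [mul_lt_mul_of_pos_right hlt hpos]

theorem UnitAddCircle.ae_coe_of_ae {P : UnitAddCircle → Prop} (h : ∀ᵐ y, P y) :
    ∀ᵐ x : ℝ, P (x : UnitAddCircle) := by
  rw [← Measure.restrict_univ (μ := (volume : Measure ℝ)), ← iUnion_Ioc_intCast ℝ,
    ae_restrict_iUnion_iff]
  intro t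
  exact (UnitAddCircle.measurePreserving_mk (t : ℝ)).quasiMeasurePreserving.ae h

theorem Real.infinite_setOf_abs_sub_lt_of_mem_addWellApproximable {ψ : ℕ → ℝ} {x : ℝ}
    (hx : (x : UnitAddCircle) ∈ addWellApproximable UnitAddCircle ψ) :
    {pq : ℤ × ℕ | 1 ≤ pq.2 ∧ |x - (pq.1 : ℝ) / (pq.2 : ℝ)| < ψ pq.2}.Infinite := by
  rw [UnitAddCircle.mem_addWellApproximable_iff] at hx
  refine Set.Infinite.of_image Prod.snd (hx.mono ?_)
  rintro n ⟨m, hm, -, hlt⟩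
  have hn : (n : ℝ) ≠ 0 := by
    have : n ≠ 0 := by lia
    exact_mod_cast this
  rw [← AddCircle.coe_sub, UnitAddCircle.norm_eq] at hlt
  refine ⟨(m + round (x - (m : ℝ) / n) * n, n), ⟨by simp; lia, ?_⟩, rfl⟩
  convert! hlt using 2
  push_cast
  field_simp
  ring

theorem Real.mem_addWellApproximable_of_forall_mem {ψ : ℕ → ℝ} {x : ℝ}
    (hx : ∀ M, ∃ N, x ∈ reducedNeighbourhood ψ M N) :
    (x : UnitAddCircle) ∈ addWellApproximable UnitAddCircle ψ := by
  rw [UnitAddCircle.mem_addWellApproximable_iff]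
  refine Set.infinite_of_forall_exists_gt fun M => ?_
  obtain ⟨N, hN⟩ := hx M
  simp only [reducedNeighbourhood, reducedNumerators, Set.mem_iUnion, Finset.mem_sigma,
    Finset.mem_Ioc, Finset.mem_filter, Finset.mem_range, exists_prop] at hN
  obtain ⟨⟨q, p⟩, ⟨⟨hMq, -⟩, hpq, hco⟩, hball⟩ := hN
  refine ⟨q, ⟨p, hpq, hco.symm, ?_⟩, hMq⟩
  rw [Metric.mem_ball, Real.dist_eq] at hball
  rw [← AddCircle.coe_sub, UnitAddCircle.norm_eq]
  refine lt_of_le_of_lt ?_ hball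
  simpa using round_le (x - (p : ℝ) / q) 0

theorem ae_mem_addWellApproximable_of_not_summable {ψ : ℕ → ℝ} (hψ0 : ∀ n, 0 ≤ ψ n)
    (hψ : Antitone ψ) (hlim : Filter.Tendsto ψ Filter.atTop (nhds 0))
    (hdiv : ¬ Summable fun m : ℕ => (m : ℝ) * ψ m) :
    ∀ᵐ y, y ∈ addWellApproximable UnitAddCircle ψ := by
  refine (AddCircle.addWellApproximable_ae_empty_or_univ (T := 1) ψ hlim).resolve_left fun h => ?_
  let V : ℕ → Set ℝ := fun M => ⋃ N, reducedNeighbourhood ψ M N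
  have hmono : Antitone V := by
    intro M M' hMM' x hx
    obtain ⟨N, hN⟩ := Set.mem_iUnion.1 hx
    refine Set.mem_iUnion.2 ⟨N, Set.biUnion_subset_biUnion_left (fun i hi => ?_) hN⟩
    exact Finset.sigma_mono (Finset.Ioc_subset_Ioc_left hMM') (fun _ => le_rfl) hi
  have hmeas : ∀ M, MeasurableSet (V M) := fun M => (isOpen_iUnion fun N =>
    isOpen_biUnion fun i _ => Metric.isOpen_ball).measurableSet
  have hbdd : ∀ M, V M ⊆ Metric.ball 0 (1 + ψ 0) := by
    intro M
    refine Set.iUnion_subset fun N => Set.iUnion₂_subset fun i hi => ?_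
    simp only [reducedNumerators, Finset.mem_sigma, Finset.mem_filter, Finset.mem_range] at hi
    refine Metric.ball_subset_ball' ?_
    have h1 : (i.2 : ℝ) / i.1 ≤ 1 := div_le_one_of_le₀ (by exact_mod_cast hi.2.1.le) (by positivity)
    have h2 := hψ (Nat.zero_le i.1)
    rw [Real.dist_eq, sub_zero, abs_of_nonneg (by positivity)]
    linarith
  have hfin : ∀ M, volume (V M) ≠ ⊤ := fun M =>
    measure_ne_top_of_subset (hbdd M) measure_ball_lt_top.ne
  have hlow : ∀ M, ENNReal.ofReal (1 / 360) ≤ volume (V M) := by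
    intro M
    obtain ⟨N, hN⟩ := exists_le_volume_reducedNeighbourhood hψ0 hψ hdiv M
    exact ENNReal.ofReal_le_of_le_toReal
      (hN.trans (measureReal_mono (Set.subset_iUnion _ N) (hfin M)))
  have hinter : ENNReal.ofReal (1 / 360) ≤ volume (⋂ M, V M) :=
    ge_of_tendsto' (tendsto_measure_iInter_atTop (fun M => (hmeas M).nullMeasurableSet) hmono
      ⟨0, hfin 0⟩) hlow
  have hzero : volume (⋂ M, V M) = 0 := by
    refine measure_mono_null (fun x hx => ?_) (UnitAddCircle.ae_coe_of_ae h)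
    refine not_not.2 (Real.mem_addWellApproximable_of_forall_mem fun M => ?_)
    exact Set.mem_iUnion.1 (Set.mem_iInter.1 hx M)
  rw [hzero, nonpos_iff_eq_zero, ENNReal.ofReal_eq_zero] at hinter
  norm_num at hinter

theorem Real.infinite_setOf_abs_sub_lt_of_le {ψ : ℕ → ℝ} {c : ℝ} (hc : 0 < c)
    (hψ : ∀ n, c ≤ ψ n) (x : ℝ) :
    {pq : ℤ × ℕ | 1 ≤ pq.2 ∧ |x - (pq.1 : ℝ) / (pq.2 : ℝ)| < ψ pq.2}.Infinite := by
  refine Set.Infinite.of_image Prod.snd (Set.infinite_of_forall_exists_gt fun M => ?_)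
  obtain ⟨k, hk⟩ := exists_nat_gt (1 / c)
  have hn : (0 : ℝ) < (M + k + 1 : ℕ) := by positivity
  refine ⟨M + k + 1, ⟨(round (x * (M + k + 1 : ℕ)), M + k + 1), ⟨by simp, ?_⟩, rfl⟩, by lia⟩
  refine lt_of_lt_of_le ?_ (hψ _)
  rw [sub_div' hn.ne', abs_div, abs_of_pos hn, div_lt_iff₀ hn]
  refine (abs_sub_round _).trans_lt ?_
  rw [div_lt_iff₀ hc] at hk
  push_cast
  nlinarith [mul_nonneg (Nat.cast_nonneg (α := ℝ) M) hc.le]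

theorem ae_infinite_setOf_abs_sub_lt_of_not_summable {ψ : ℕ → ℝ} (hψ0 : ∀ n, 0 ≤ ψ n)
    (hψ : Antitone ψ) (hdiv : ¬ Summable fun m : ℕ => (m : ℝ) * ψ m) :
    ∀ᵐ x : ℝ, {pq : ℤ × ℕ | 1 ≤ pq.2 ∧ |x - (pq.1 : ℝ) / (pq.2 : ℝ)| < ψ pq.2}.Infinite := by
  by_cases hc : ∃ c > 0, ∀ n, c ≤ ψ n
  · obtain ⟨c, hc, hle⟩ := hc
    exact .of_forall (Real.infinite_setOf_abs_sub_lt_of_le hc hle)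
  · push Not at hc
    have hlim : Filter.Tendsto ψ Filter.atTop (nhds 0) := by
      refine Metric.tendsto_atTop.2 fun ε hε => ?_
      obtain ⟨n, hn⟩ := hc ε hε
      refine ⟨n, fun m hm => ?_⟩
      rw [Real.dist_eq, sub_zero, abs_of_nonneg (hψ0 m)]
      exact (hψ hm).trans_lt hn
    filter_upwards [UnitAddCircle.ae_coe_of_ae
      (ae_mem_addWellApproximable_of_not_summable hψ0 hψ hlim hdiv)] with x hx
    exact Real.infinite_setOf_abs_sub_lt_of_mem_addWellApproximable hx

theorem ae_finite_setOf_abs_sub_lt_and_le {ψ : ℕ → ℝ} (hψ0 : ∀ n, 0 ≤ ψ n)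
    (hsum : Summable fun m : ℕ => (m : ℝ) * ψ m) (C : ℕ) :
    ∀ᵐ x : ℝ, {pq : ℤ × ℕ | (1 ≤ pq.2 ∧ |pq.1| ≤ C * pq.2) ∧
      |x - (pq.1 : ℝ) / (pq.2 : ℝ)| < ψ pq.2}.Finite := by
  classical
  let A : ℕ × ℤ → Set ℝ := fun qp =>
    if 1 ≤ qp.1 ∧ |qp.2| ≤ C * qp.1 then Metric.ball ((qp.2 : ℝ) / qp.1) (ψ qp.1) else ∅
  have hA : ∑' i, volume (A i) ≠ ⊤ := by
    rw [ENNReal.tsum_prod']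
    have hq : ∀ q : ℕ, ∑' p : ℤ, volume (A (q, p)) ≤
        ENNReal.ofReal ((2 * (2 * C + 1)) * (q * ψ q)) := by
      intro q
      rcases Nat.eq_zero_or_pos q with rfl | hq
      · simp [A]
      rw [tsum_eq_sum (s := Finset.Icc (-(C * q : ℤ)) (C * q)) fun p hp => by
        have : ¬ |p| ≤ C * q := fun h => hp (Finset.mem_Icc.2 (abs_le.1 h))
        simp [A, this]]
      refine (Finset.sum_le_card_nsmul _ _ (ENNReal.ofReal (2 * ψ q)) fun p _ => ?_).trans ?_
      · simp only [A]
        split_ifs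
        · rw [Real.volume_ball]
        · simp
      · rw [nsmul_eq_mul, Int.card_Icc, ← ENNReal.ofReal_natCast,
          ← ENNReal.ofReal_mul (Nat.cast_nonneg _)]
        refine ENNReal.ofReal_le_ofReal ?_
        have h1 : ((C * q : ℤ) + 1 - -(C * q : ℤ)).toNat ≤ (2 * C + 1) * q := by
          rw [Int.toNat_le]
          push_cast
          nlinarith
        have h2 : (((C * q : ℤ) + 1 - -(C * q : ℤ)).toNat : ℝ) ≤ (2 * C + 1) * q := by
          exact_mod_cast h1
        have := mul_le_mul_of_nonneg_right h2 (mul_nonneg zero_le_two (hψ0 q))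
        linarith
    refine ne_top_of_le_ne_top ?_ (ENNReal.tsum_le_tsum hq)
    exact (hsum.mul_left _).tsum_ofReal_ne_top
  filter_upwards [ae_finite_setOfPred_mem hA] with x hx
  refine (hx.image Prod.swap).subset ?_
  rintro ⟨p, q⟩ ⟨h, hlt⟩
  refine ⟨(q, p), ?_, rfl⟩
  have : A (q, p) = Metric.ball ((p : ℝ) / q) (ψ q) := if_pos h
  change x ∈ A (q, p)
  rwa [this, Metric.mem_ball, Real.dist_eq]

theorem ae_finite_setOf_abs_sub_lt_of_summable {ψ : ℕ → ℝ} (hψ0 : ∀ n, 0 ≤ ψ n)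
    (hψ : Antitone ψ) (hsum : Summable fun m : ℕ => (m : ℝ) * ψ m) :
    ∀ᵐ x : ℝ, {pq : ℤ × ℕ | 1 ≤ pq.2 ∧ |x - (pq.1 : ℝ) / (pq.2 : ℝ)| < ψ pq.2}.Finite := by
  filter_upwards [ae_all_iff.2 (ae_finite_setOf_abs_sub_lt_and_le hψ0 hsum)] with x hx
  obtain ⟨C, hC⟩ := exists_nat_ge (|x| + ψ 0)
  refine (hx C).subset ?_
  rintro ⟨p, q⟩ ⟨hq, hlt⟩
  refine ⟨⟨hq, ?_⟩, hlt⟩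
  have hq' : (0 : ℝ) < q := by exact_mod_cast hq
  have h1 : |(p : ℝ) / q| ≤ C := by
    have h2 := abs_sub_abs_le_abs_sub ((p : ℝ) / q) x
    rw [abs_sub_comm] at h2
    have h3 := hψ (Nat.zero_le q)
    simp only at hlt
    linarith
  rw [abs_div, abs_of_pos hq', div_le_iff₀ hq'] at h1
  exact_mod_cast h1

/-- **Khintchine's theorem.** For a non-increasing `ψ : ℕ → ℝ_{>0}`: if `Σ m ψ(m)` diverges
then for Lebesgue-a.e. `x` the inequality `|x - p/q| < ψ(q)` has infinitely many solutions
`(p,q) ∈ ℤ × ℕ` (`q ≥ 1`); if `Σ m ψ(m)` converges then for Lebesgue-a.e. `x` it has only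
finitely many solutions. -/
theorem khintchine (ψ : ℕ → ℝ) (hψpos : ∀ n, 0 < ψ n) (hψmono : Antitone ψ) :
    (¬ Summable (fun m : ℕ => (m : ℝ) * ψ m) →
      ∀ᵐ x ∂(volume : Measure ℝ),
        {pq : ℤ × ℕ | 1 ≤ pq.2 ∧ |x - (pq.1 : ℝ) / (pq.2 : ℝ)| < ψ pq.2}.Infinite) ∧
    (Summable (fun m : ℕ => (m : ℝ) * ψ m) →
      ∀ᵐ x ∂(volume : Measure ℝ),
        {pq : ℤ × ℕ | 1 ≤ pq.2 ∧ |x - (pq.1 : ℝ) / (pq.2 : ℝ)| < ψ pq.2}.Finite) := by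
  exact ⟨ae_infinite_setOf_abs_sub_lt_of_not_summable (fun n => (hψpos n).le) hψmono,
    ae_finite_setOf_abs_sub_lt_of_summable (fun n => (hψpos n).le) hψmono⟩
end

section
/- (Jarník) The set Bad of badly approximable real numbers has full Hausdorff dimension: dim_H(Bad) = 1. -/
/-- The set `Bad = ⋃_{c>0} Bad(c)` of badly approximable real numbers: those `x` for which
there exists `c > 0` with `|x - p/q| ≥ c/q²` for every rational `p/q` (`p ∈ ℤ`, `q ≥ 1`). -/
def badReal : Set ℝ :=
  {x | ∃ c : ℝ, 0 < c ∧ ∀ p : ℤ, ∀ q : ℕ, 1 ≤ q →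
      c / (q : ℝ) ^ 2 ≤ |x - (p : ℝ) / (q : ℝ)|}

open Set

/-- If `f` contracts distances on `s` at most in a Hölder way, then it does not decrease the
Hausdorff dimension of `s` by more than the Hölder exponent. -/
theorem mul_dimH_le_dimH_image_of_dist_le {X Y : Type*} [MetricSpace X] [MetricSpace Y]
    {f : X → Y} {s : Set X} {C r : NNReal} (hr : 0 < r)
    (h : ∀ a ∈ s, ∀ b ∈ s, dist a b ≤ C * dist (f a) (f b) ^ (r : ℝ)) :
    r * dimH s ≤ dimH (f '' s) := by
  rcases s.eq_empty_or_nonempty with rfl | ⟨a₀, -⟩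
  · simp
  have : Nonempty X := ⟨a₀⟩
  have hr' : (0 : ℝ) < r := hr
  have hinj : InjOn f s := fun a ha b hb hab => by
    have := h a ha b hb
    rw [hab, dist_self, Real.zero_rpow hr'.ne', mul_zero] at this
    exact dist_le_zero.1 this
  have hinv := hinj.leftInvOn_invFunOn
  have hg : HolderOnWith C r (Function.invFunOn f s) (f '' s) := by
    rintro _ ⟨a, ha, rfl⟩ _ ⟨b, hb, rfl⟩
    rw [hinv ha, hinv hb, edist_nndist, edist_nndist,
      ← ENNReal.coe_rpow_of_nonneg _ hr'.le, ← ENNReal.coe_mul, ENNReal.coe_le_coe,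
      ← NNReal.coe_le_coe]
    simpa using h a ha b hb
  have := hg.dimH_image_le hr
  rw [hinv.image_image] at this
  rw [mul_comm]
  exact (ENNReal.le_div_iff_mul_le (by simp [hr.ne']) (by simp)).1 this

/-- Two distinct fractions with denominators `q`, `q'` satisfying `4 q², 4 q'² < N` are at
distance more than `4 / N`. -/
theorem four_lt_mul_abs_div_sub_div {p p' : ℤ} {q q' : ℕ} {N : ℝ} (hq : 1 ≤ q) (hq' : 1 ≤ q')
    (hN : 4 * (q : ℝ) ^ 2 < N) (hN' : 4 * (q' : ℝ) ^ 2 < N)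
    (hne : (p : ℝ) / q ≠ p' / q') : 4 < N * |(p : ℝ) / q - p' / q'| := by
  have h0 : (0 : ℝ) < q := by exact_mod_cast hq
  have h0' : (0 : ℝ) < q' := by exact_mod_cast hq'
  have hz : p * q' - q * p' ≠ 0 := by
    intro h
    apply hne
    rw [div_eq_div_iff h0.ne' h0'.ne']
    have : (p * q' - q * p' : ℝ) = 0 := by exact_mod_cast h
    linarith
  have h1 : (1 : ℝ) ≤ |(p * q' - q * p' : ℝ)| := by exact_mod_cast Int.one_le_abs hz
  rw [div_sub_div _ _ h0.ne' h0'.ne', abs_div, abs_of_pos (mul_pos h0 h0'), ← mul_div_assoc,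
    lt_div_iff₀ (mul_pos h0 h0')]
  nlinarith [sq_nonneg ((q : ℝ) - q')]

namespace Jarnik

/-- There is a fraction of denominator less than `√((4M)ⁿ) / 2` close to the left half of the
interval `[k, k + 1] / (4M)ⁿ`. -/
def LeftHalfHit (M n : ℕ) (k : ℤ) : Prop :=
  ∃ p : ℤ, ∃ q : ℕ, 1 ≤ q ∧ 4 * (q : ℝ) ^ 2 < (4 * M : ℝ) ^ n ∧
    k - 1 / 4 ≤ (4 * M : ℝ) ^ n * (p / q) ∧ (4 * M : ℝ) ^ n * (p / q) ≤ k + 1 / 2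

open Classical in
/-- The offset selecting the last or the first quarter of `[k, k + 1] / (4M)ⁿ`. -/
noncomputable def offset (M n : ℕ) (k : ℤ) : ℤ :=
  if LeftHalfHit M n k then 3 * M else 0

/-- The position, in units of `(4M)⁻ⁿ`, of the `m`-th interval of level `n` of the Cantor set. -/
noncomputable def index (M : ℕ) : ℕ → ℤ → ℤ
  | 0, m => m
  | n + 1, m => 4 * M * index M n (m / M) + m % M + offset M n (index M n (m / M))

theorem offset_nonneg (M n : ℕ) (k : ℤ) : 0 ≤ offset M n k := by
  unfold offset; split_ifs <;> omega

theorem offset_le (M n : ℕ) (k : ℤ) : offset M n k ≤ 3 * M := by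
  unfold offset; split_ifs <;> omega

theorem index_strictMono {M : ℕ} (hM : 0 < M) (n : ℕ) : StrictMono (index M n) := by
  have hM' : (0 : ℤ) < M := by exact_mod_cast hM
  induction n with
  | zero => exact fun _ _ h => h
  | succ n ih =>
    intro a b hab
    have ha := Int.mul_ediv_add_emod a M
    have hb := Int.mul_ediv_add_emod b M
    simp only [index]
    rcases (Int.ediv_le_ediv hM' hab.le).eq_or_lt with h | h
    · rw [h] at ha ⊢
      linarith
    · have h1 : index M n (a / M) + 1 ≤ index M n (b / M) := ih h
      have h2 := offset_le M n (index M n (a / M))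
      have h3 := offset_nonneg M n (index M n (b / M))
      have h4 := Int.emod_lt_of_pos a hM'
      have h5 := Int.emod_nonneg b hM'.ne'
      nlinarith

/-- The left endpoint of the level `n` interval around the point of the Cantor set with
parameter `t`. -/
noncomputable def left (M : ℕ) (t : ℝ) (n : ℕ) : ℝ :=
  index M n ⌊(M : ℝ) ^ n * t⌋ / (4 * M : ℝ) ^ n

/-- The right endpoint of the level `n` interval around the point of the Cantor set with
parameter `t`. -/
noncomputable def right (M : ℕ) (t : ℝ) (n : ℕ) : ℝ :=
  (index M n ⌊(M : ℝ) ^ n * t⌋ + 1) / (4 * M : ℝ) ^ n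

/-- The point of the Cantor set with parameter `t`. -/
noncomputable def point (M : ℕ) (t : ℝ) : ℝ := ⨆ n, left M t n

variable {M : ℕ}

theorem exists_index_succ_eq (hM : 0 < M) (t : ℝ) (n : ℕ) :
    ∃ d : ℤ, 0 ≤ d ∧ d + 1 ≤ M ∧ index M (n + 1) ⌊(M : ℝ) ^ (n + 1) * t⌋ =
      4 * M * index M n ⌊(M : ℝ) ^ n * t⌋ + d + offset M n (index M n ⌊(M : ℝ) ^ n * t⌋) := by
  have hM' : (0 : ℤ) < M := by exact_mod_cast hM
  have hM0 : (M : ℝ) ≠ 0 := by exact_mod_cast hM.ne'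
  have h : ⌊(M : ℝ) ^ (n + 1) * t⌋ / (M : ℤ) = ⌊(M : ℝ) ^ n * t⌋ := by
    rw [← Int.floor_div_natCast]
    congr 1
    field_simp
    ring
  exact ⟨_, Int.emod_nonneg _ hM'.ne', Int.emod_lt_of_pos _ hM', by rw [index, h]⟩

theorem left_le_left_succ (hM : 0 < M) (t : ℝ) (n : ℕ) : left M t n ≤ left M t (n + 1) := by
  obtain ⟨d, hd, -, h⟩ := exists_index_succ_eq hM t n
  have hM0 : (0 : ℝ) < M := by exact_mod_cast hM
  have h0 := offset_nonneg M n (index M n ⌊(M : ℝ) ^ n * t⌋)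
  rw [left, left, h, div_le_div_iff₀ (by positivity) (by positivity), pow_succ]
  have h1 : (0 : ℝ) ≤ d + offset M n (index M n ⌊(M : ℝ) ^ n * t⌋) := by
    exact_mod_cast add_nonneg hd h0
  push_cast
  have h2 : (0 : ℝ) < (4 * M) ^ n := by positivity
  nlinarith [mul_nonneg h1 h2.le]

theorem right_succ_le_right (hM : 0 < M) (t : ℝ) (n : ℕ) : right M t (n + 1) ≤ right M t n := by
  obtain ⟨d, -, hd, h⟩ := exists_index_succ_eq hM t n
  have hM0 : (0 : ℝ) < M := by exact_mod_cast hM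
  have h0 := offset_le M n (index M n ⌊(M : ℝ) ^ n * t⌋)
  rw [right, right, h, div_le_div_iff₀ (by positivity) (by positivity), pow_succ]
  have h1 : (d + 1 + offset M n (index M n ⌊(M : ℝ) ^ n * t⌋) : ℝ) ≤ 4 * M := by
    exact_mod_cast (by linarith : d + 1 + offset M n (index M n ⌊(M : ℝ) ^ n * t⌋) ≤ 4 * M)
  push_cast
  have h2 : (0 : ℝ) < (4 * M) ^ n := by positivity
  nlinarith [mul_le_mul_of_nonneg_right h1 h2.le]

theorem point_mem_Icc (hM : 0 < M) (t : ℝ) (n : ℕ) :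
    point M t ∈ Icc (left M t n) (right M t n) := by
  have h : Antitone fun n => Icc (left M t n) (right M t n) :=
    antitone_nat_of_succ_le fun n =>
      Icc_subset_Icc (left_le_left_succ hM t n) (right_succ_le_right hM t n)
  refine mem_iInter.1 (ciSup_mem_iInter_Icc_of_antitone_Icc h fun n => ?_) n
  unfold left right
  gcongr
  linarith

theorem index_le_mul_point (hM : 0 < M) (t : ℝ) (n : ℕ) :
    index M n ⌊(M : ℝ) ^ n * t⌋ ≤ (4 * M : ℝ) ^ n * point M t := by
  have hM0 : (0 : ℝ) < M := by exact_mod_cast hM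
  have := (point_mem_Icc hM t n).1
  rwa [left, div_le_iff₀' (by positivity)] at this

theorem mul_point_le_index (hM : 0 < M) (t : ℝ) (n : ℕ) :
    (4 * M : ℝ) ^ n * point M t ≤ index M n ⌊(M : ℝ) ^ n * t⌋ + 1 := by
  have hM0 : (0 : ℝ) < M := by exact_mod_cast hM
  have := (point_mem_Icc hM t n).2
  rwa [right, le_div_iff₀' (by positivity)] at this

theorem one_div_four_le_mul_abs_point_sub (hM : 0 < M) (t : ℝ) {n q : ℕ} (p : ℤ) (hq : 1 ≤ q)
    (hqn : 4 * (q : ℝ) ^ 2 < (4 * M : ℝ) ^ n) :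
    1 / 4 ≤ (4 * M : ℝ) ^ n * |point M t - p / q| := by
  have hM0 : (0 : ℝ) < M := by exact_mod_cast hM
  have hN : (0 : ℝ) < (4 * M : ℝ) ^ n := by positivity
  obtain ⟨d, hd, hd', h⟩ := exists_index_succ_eq hM t n
  have hlow := index_le_mul_point hM t (n + 1)
  have hupp := mul_point_le_index hM t (n + 1)
  rw [h, pow_succ] at hlow hupp
  push_cast at hlow hupp
  set k := index M n ⌊(M : ℝ) ^ n * t⌋
  set N := (4 * M : ℝ) ^ n
  have hdR : (0 : ℝ) ≤ d := by exact_mod_cast hd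
  have hdR' : (d + 1 : ℝ) ≤ M := by exact_mod_cast hd'
  by_contra! hlt
  rw [← abs_of_pos hN, ← abs_mul, abs_lt, mul_sub] at hlt
  obtain ⟨hlt₁, hlt₂⟩ := hlt
  by_cases hk : LeftHalfHit M n k
  · rw [offset, if_pos hk] at hlow hupp
    push_cast at hlow hupp
    have h1 : k + 3 / 4 ≤ N * point M t := le_of_mul_le_mul_left (by linarith) hM0
    have h2 : N * point M t ≤ k + 1 := le_of_mul_le_mul_left (by linarith) hM0
    obtain ⟨p', q', hq', hqn', h3, h4⟩ := hk
    have hne : (p : ℝ) / q ≠ p' / q' := fun he => by rw [he] at hlt₂; linarith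
    have := four_lt_mul_abs_div_sub_div hq hq' hqn hqn' hne
    rw [← abs_of_pos hN, ← abs_mul, lt_abs, mul_sub] at this
    rcases this with this | this <;> linarith
  · rw [offset, if_neg hk] at hlow hupp
    push_cast at hlow hupp
    have h1 : k ≤ N * point M t := le_of_mul_le_mul_left (by linarith) hM0
    have h2 : N * point M t ≤ k + 1 / 4 := le_of_mul_le_mul_left (by linarith) hM0
    exact hk ⟨p, q, hq, hqn, by linarith, by linarith⟩

theorem point_mem_badReal (hM : 0 < M) (t : ℝ) : point M t ∈ badReal := by
  have hM1 : (1 : ℝ) ≤ M := by exact_mod_cast hM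
  refine ⟨1 / (64 * M), by positivity, fun p q hq => ?_⟩
  have hq0 : (1 : ℝ) ≤ q := by exact_mod_cast hq
  obtain ⟨n, hn, hn'⟩ := exists_nat_pow_near (x := 4 * (q : ℝ) ^ 2) (y := 4 * (M : ℝ))
    (by nlinarith) (by linarith)
  have h := one_div_four_le_mul_abs_point_sub hM t p hq hn'
  rw [div_div, div_le_iff₀ (by positivity)]
  have h1 : (4 * M : ℝ) ^ (n + 1) ≤ 4 * (q : ℝ) ^ 2 * (4 * M) := by
    rw [pow_succ]; gcongr
  have := mul_le_mul_of_nonneg_right h1 (abs_nonneg (point M t - p / q))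
  linarith

theorem one_le_mul_point_sub_point (hM : 0 < M) {s t : ℝ} {n : ℕ}
    (h : 2 ≤ (M : ℝ) ^ n * (t - s)) : 1 ≤ (4 * M : ℝ) ^ n * (point M t - point M s) := by
  have hmono := index_strictMono hM n
  have hfl : ⌊(M : ℝ) ^ n * s⌋ + 2 ≤ ⌊(M : ℝ) ^ n * t⌋ := by
    rw [Int.le_floor]
    push_cast
    linarith [Int.floor_le ((M : ℝ) ^ n * s)]
  have h2 : index M n ⌊(M : ℝ) ^ n * s⌋ + 2 ≤ index M n ⌊(M : ℝ) ^ n * t⌋ := by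
    have h3 := hmono (lt_add_one ⌊(M : ℝ) ^ n * s⌋)
    have h4 := hmono (show ⌊(M : ℝ) ^ n * s⌋ + 1 < ⌊(M : ℝ) ^ n * t⌋ by omega)
    omega
  have h2' : (index M n ⌊(M : ℝ) ^ n * s⌋ + 2 : ℝ) ≤ index M n ⌊(M : ℝ) ^ n * t⌋ := by
    exact_mod_cast h2
  have := index_le_mul_point hM t n
  have := mul_point_le_index hM s n
  rw [mul_sub]
  linarith

theorem sub_le_mul_rpow_point_sub_point (hM : 1 < M) {r : ℝ} (hr : 0 ≤ r)
    (hMr : (4 * M : ℝ) ^ r = M) {s t : ℝ} (hst : s < t) (hst' : t - s ≤ 1) :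
    t - s ≤ 2 * M * |point M t - point M s| ^ r := by
  have hM0 : 0 < M := by omega
  have hM1 : (1 : ℝ) < M := by exact_mod_cast hM
  have hpos : 0 < t - s := sub_pos.2 hst
  obtain ⟨n, hn, hn'⟩ := exists_nat_pow_near (x := 2 / (t - s)) (y := (M : ℝ))
    ((one_le_div hpos).2 (by linarith)) hM1
  have h := one_le_mul_point_sub_point hM0 (n := n + 1) ((div_lt_iff₀ hpos).1 hn').le
  rw [le_div_iff₀ hpos] at hn
  have hδ : 0 < point M t - point M s := pos_of_mul_pos_right (one_pos.trans_le h) (by positivity)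
  have h1 : 1 ≤ (M : ℝ) ^ (n + 1) * (point M t - point M s) ^ r := by
    have := Real.one_le_rpow h hr
    rwa [Real.mul_rpow (by positivity) hδ.le, ← Real.rpow_natCast, ← Real.rpow_mul (by positivity),
      mul_comm _ r, Real.rpow_mul (by positivity), hMr, Real.rpow_natCast] at this
  rw [abs_of_pos hδ]
  have hMn : (0 : ℝ) < M ^ n := by positivity
  refine le_of_mul_le_mul_left (hn.trans ?_) hMn
  rw [pow_succ] at h1
  linarith

theorem le_dimH_badReal (hM : 1 < M) {r : NNReal} (hr : 0 < r) (hMr : (4 * M : ℝ) ^ (r : ℝ) = M) :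
    (r : ENNReal) ≤ dimH badReal := by
  have hdim : dimH (Icc (0 : ℝ) 1) = 1 := by
    rw [Real.dimH_of_nonempty_interior (by simp)]
    simp
  have h : (r : ENNReal) * dimH (Icc (0 : ℝ) 1) ≤ dimH (point M '' Icc 0 1) := by
    refine mul_dimH_le_dimH_image_of_dist_le (C := 2 * M) hr fun a ha b hb => ?_
    simp only [Real.dist_eq]
    push_cast
    rcases lt_trichotomy a b with hab | rfl | hab
    · rw [abs_sub_comm, abs_sub_comm (point M a), abs_of_pos (sub_pos.2 hab)]
      exact sub_le_mul_rpow_point_sub_point hM r.2 hMr hab (by linarith [ha.1, hb.2])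
    · simp only [sub_self, abs_zero]
      positivity
    · rw [abs_of_pos (sub_pos.2 hab)]
      exact sub_le_mul_rpow_point_sub_point hM r.2 hMr hab (by linarith [hb.1, ha.2])
  rw [hdim, mul_one] at h
  refine h.trans (dimH_mono ?_)
  rintro _ ⟨t, -, rfl⟩
  exact point_mem_badReal (by omega) t

end Jarnik

/-- **Jarník's theorem.** The set of badly approximable numbers has full Hausdorff
dimension: `dim_H(Bad) = 1`. -/
theorem jarnik : dimH badReal = 1 := by
  refine le_antisymm ((dimH_mono (subset_univ _)).trans_eq Real.dimH_univ) ?_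
  have hle (j : ℕ) : (((j + 1 : NNReal) / (j + 1 + 1) : NNReal) : ENNReal) ≤ dimH badReal := by
    refine Jarnik.le_dimH_badReal (M := 4 ^ (j + 1)) (Nat.one_lt_pow (by omega) (by omega))
      (by positivity) ?_
    push_cast
    rw [← pow_succ', ← Real.rpow_natCast, ← Real.rpow_mul (by norm_num), ← Real.rpow_natCast]
    congr 1
    push_cast
    field_simp
  have hlim : Filter.Tendsto (fun j : ℕ => (j + 1 : NNReal) / (j + 1 + 1))
      Filter.atTop (nhds 1) := by
    rw [← NNReal.tendsto_coe]
    push_cast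
    have := (tendsto_natCast_div_add_atTop (1 : ℝ)).comp (Filter.tendsto_add_atTop_nat 1)
    simpa [Function.comp_def] using this
  exact le_of_tendsto' (ENNReal.tendsto_coe.2 hlim) hle
end

section
/- For every integer N ≥ 1 and every θ ∈ (0,1), setting r = sin θ, one has (1/N)·(5/6)^{N−1}·r^N ≤ ∫₀^θ sin^{N−1}(z) dz ≤ (1/N)·(6/5)^N·r^N. -/
open intervalIntegral

/-- The chord-type lower bound `5x/6 ≤ sin x` on `[0, 1]`. -/
theorem five_sixths_mul_le_sin {x : ℝ} (h0 : 0 ≤ x) (h1 : x ≤ 1) :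
    5 / 6 * x ≤ Real.sin x := by
  rcases h0.eq_or_lt with rfl | hx
  · simp
  · have hcube : x ^ 3 ≤ x := pow_le_of_le_one h0 h1 (by norm_num)
    linarith [Real.sin_gt_sub_cube hx]

/-- For `N ≥ 1`, `θ ∈ (0,1)` and `r = sin θ`:
`(1/N)(5/6)^{N-1} r^N ≤ ∫₀^θ sin^{N-1} z dz ≤ (1/N)(6/5)^N r^N`. -/
theorem sin_pow_integral_bounds (N : ℕ) (hN : 1 ≤ N) (θ : ℝ) (h0 : 0 < θ) (h1 : θ < 1) :
    (1 / (N : ℝ)) * (5 / 6) ^ (N - 1) * Real.sin θ ^ N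
        ≤ ∫ z in (0 : ℝ)..θ, Real.sin z ^ (N - 1) ∧
    (∫ z in (0 : ℝ)..θ, Real.sin z ^ (N - 1))
        ≤ (1 / (N : ℝ)) * (6 / 5) ^ N * Real.sin θ ^ N := by
  obtain ⟨n, rfl⟩ := Nat.exists_eq_add_of_le' hN
  simp only [Nat.add_sub_cancel]
  have hsin : 0 ≤ Real.sin θ := (by positivity : (0 : ℝ) ≤ 5 / 6 * θ).trans
    (five_sixths_mul_le_sin h0.le h1.le)
  have hint : ∀ c : ℝ, ∫ z in (0 : ℝ)..θ, (c * z) ^ n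
      = 1 / ((n + 1 : ℕ) : ℝ) * c ^ n * θ ^ (n + 1) := by
    intro c
    simp only [mul_pow, intervalIntegral.integral_const_mul, integral_pow]
    push_cast
    ring
  constructor
  · calc 1 / ((n + 1 : ℕ) : ℝ) * (5 / 6) ^ n * Real.sin θ ^ (n + 1)
        ≤ 1 / ((n + 1 : ℕ) : ℝ) * (5 / 6) ^ n * θ ^ (n + 1) := by
          gcongr
          exact Real.sin_le h0.le
      _ = ∫ z in (0 : ℝ)..θ, (5 / 6 * z) ^ n := (hint _).symm
      _ ≤ ∫ z in (0 : ℝ)..θ, Real.sin z ^ n := by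
          refine intervalIntegral.integral_mono_on h0.le
            (Continuous.intervalIntegrable (by fun_prop) _ _)
            (Continuous.intervalIntegrable (by fun_prop) _ _) fun z hz => ?_
          have hz0 := hz.1
          exact pow_le_pow_left₀ (by positivity)
            (five_sixths_mul_le_sin hz0 (hz.2.trans h1.le)) n
  · calc ∫ z in (0 : ℝ)..θ, Real.sin z ^ n
        ≤ ∫ z in (0 : ℝ)..θ, (1 * z) ^ n := by
          refine intervalIntegral.integral_mono_on h0.le
            (Continuous.intervalIntegrable (by fun_prop) _ _)
            (Continuous.intervalIntegrable (by fun_prop) _ _) fun z hz => ?_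
          have hz0 := hz.1
          rw [one_mul]
          exact pow_le_pow_left₀ ((by positivity : (0 : ℝ) ≤ 5 / 6 * z).trans
            (five_sixths_mul_le_sin hz0 (hz.2.trans h1.le))) (Real.sin_le hz0) n
      _ = 1 / ((n + 1 : ℕ) : ℝ) * θ ^ (n + 1) := by rw [hint, one_pow, mul_one]
      _ ≤ 1 / ((n + 1 : ℕ) : ℝ) * (6 / 5 * Real.sin θ) ^ (n + 1) := by
          gcongr
          linarith [five_sixths_mul_le_sin h0.le h1.le]
      _ = 1 / ((n + 1 : ℕ) : ℝ) * (6 / 5) ^ (n + 1) * Real.sin θ ^ (n + 1) := by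
          rw [mul_pow, mul_assoc]
end

section
/- (Choi–Vaaler, p-adic case for k = ℚ) Let N ≥ 1 and let p be a prime. There exists a constant c > 0 such that for every x̂ ∈ ℙ^N(ℚ_p) ∖ ℙ^N(ℚ) there exist infinitely many rational points q̂ ∈ ℙ^N(ℚ) satisfying δ_p(x̂, q̂) < c / H(q̂)^{(N+1)/N}. -/
open scoped Classical

noncomputable section

/-- Projective `N`-space over the `p`-adic numbers. -/
abbrev PProj (p : ℕ) [Fact p.Prime] (N : ℕ) :=
  Projectivization ℚ_[p] (Fin (N + 1) → ℚ_[p])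

/-- The sup norm `‖x‖_p = max_i |x_i|_p` of a vector over `ℚ_p`. -/
def pvnorm {p : ℕ} [Fact p.Prime] {N : ℕ} (x : Fin (N + 1) → ℚ_[p]) : ℝ :=
  Finset.univ.sup' Finset.univ_nonempty fun i => ‖x i‖

/-- The sup norm `‖x ∧ y‖_p = max_{i<j} |x_i y_j - x_j y_i|_p` of the wedge of two vectors. -/
def pwnorm {p : ℕ} [Fact p.Prime] {N : ℕ} (x y : Fin (N + 1) → ℚ_[p]) : ℝ :=
  Finset.univ.sup' Finset.univ_nonempty fun ij : Fin (N + 1) × Fin (N + 1) =>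
    ‖x ij.1 * y ij.2 - x ij.2 * y ij.1‖

/-- The projective metric `δ_p` on `ℙ^N(ℚ_p)`. -/
def pdistP {p : ℕ} [Fact p.Prime] {N : ℕ} (a b : PProj p N) : ℝ :=
  pwnorm a.rep b.rep / (pvnorm a.rep * pvnorm b.rep)

/-- Cast an integer vector to `ℚ_p^{N+1}`. -/
def castVecP (p : ℕ) [Fact p.Prime] {N : ℕ} (q : Fin (N + 1) → ℤ) : Fin (N + 1) → ℚ_[p] :=
  fun i => (q i : ℚ_[p])

/-- The integer vector has coprime coordinates (in particular it is nonzero). -/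
def coprimeVec {N : ℕ} (q : Fin (N + 1) → ℤ) : Prop := Finset.univ.gcd q = 1

/-- The rational point of `ℙ^N(ℚ_p)` with homogeneous coordinates `q` (junk if `q = 0`). -/
def ratPtP (p : ℕ) [Fact p.Prime] {N : ℕ} (q : Fin (N + 1) → ℤ) : PProj p N :=
  if h : castVecP p q = 0 then
    Projectivization.mk ℚ_[p] (fun _ => (1 : ℚ_[p])) (fun h0 => one_ne_zero (congrFun h0 0))
  else Projectivization.mk ℚ_[p] (castVecP p q) h

/-- The height of an integer vector: the maximum absolute value of its coordinates. -/
def Ht {N : ℕ} (q : Fin (N + 1) → ℤ) : ℕ := Finset.univ.sup fun i => (q i).natAbs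

lemma pvnorm_eq_norm {p : ℕ} [Fact p.Prime] {N : ℕ} (x : Fin (N + 1) → ℚ_[p]) :
    pvnorm x = ‖x‖ := by
  apply le_antisymm
  · exact Finset.sup'_le _ _ fun i _ => norm_le_pi_norm x i
  · rw [pi_norm_le_iff_of_nonempty]
    exact fun i => Finset.le_sup' (fun i => ‖x i‖) (Finset.mem_univ i)

lemma pwnorm_eq_norm {p : ℕ} [Fact p.Prime] {N : ℕ} (x y : Fin (N + 1) → ℚ_[p]) :
    pwnorm x y = ‖fun ij : Fin (N + 1) × Fin (N + 1) => x ij.1 * y ij.2 - x ij.2 * y ij.1‖ := by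
  apply le_antisymm
  · exact Finset.sup'_le _ _ fun ij _ => norm_le_pi_norm
      (fun ij : Fin (N + 1) × Fin (N + 1) => x ij.1 * y ij.2 - x ij.2 * y ij.1) ij
  · rw [pi_norm_le_iff_of_nonempty]
    exact fun ij => Finset.le_sup' (fun ij : Fin (N + 1) × Fin (N + 1) =>
      ‖x ij.1 * y ij.2 - x ij.2 * y ij.1‖) (Finset.mem_univ ij)

lemma pwnorm_smul_smul {p : ℕ} [Fact p.Prime] {N : ℕ} (a b : ℚ_[p])
    (x y : Fin (N + 1) → ℚ_[p]) : pwnorm (a • x) (b • y) = ‖a‖ * ‖b‖ * pwnorm x y := by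
  rw [pwnorm_eq_norm, pwnorm_eq_norm, ← norm_mul, ← norm_smul]
  congr 1
  ext ij
  simp only [Pi.smul_apply, smul_eq_mul]
  ring

lemma pdistP_mk {p : ℕ} [Fact p.Prime] {N : ℕ} (x y : Fin (N + 1) → ℚ_[p])
    (hx : x ≠ 0) (hy : y ≠ 0) :
    pdistP (Projectivization.mk ℚ_[p] x hx) (Projectivization.mk ℚ_[p] y hy) =
      pwnorm x y / (‖x‖ * ‖y‖) := by
  obtain ⟨a, ha⟩ := Projectivization.exists_smul_eq_mk_rep ℚ_[p] x hx
  obtain ⟨b, hb⟩ := Projectivization.exists_smul_eq_mk_rep ℚ_[p] y hy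
  rw [pdistP, ← ha, ← hb, pvnorm_eq_norm, pvnorm_eq_norm, Units.smul_def, Units.smul_def,
    pwnorm_smul_smul, norm_smul, norm_smul]
  have h1 : ‖(a : ℚ_[p])‖ ≠ 0 := norm_ne_zero_iff.2 a.ne_zero
  have h2 : ‖(b : ℚ_[p])‖ ≠ 0 := norm_ne_zero_iff.2 b.ne_zero
  rw [mul_mul_mul_comm ‖(a : ℚ_[p])‖, mul_div_mul_left _ _ (mul_ne_zero h1 h2)]

/-- Every point has homogeneous coordinates in `ℤ_p`, one of them equal to `1`. -/
lemma PProj.exists_integral_coords {p : ℕ} [Fact p.Prime] {N : ℕ} (x : PProj p N) :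
    ∃ (v : Fin (N + 1) → ℤ_[p]) (i₀ : Fin (N + 1)) (hv : (fun i => (v i : ℚ_[p])) ≠ 0),
      v i₀ = 1 ∧ x = Projectivization.mk ℚ_[p] (fun i => (v i : ℚ_[p])) hv := by
  obtain ⟨i₀, hi₀⟩ := Finite.exists_max fun i => ‖x.rep i‖
  have h0 : x.rep i₀ ≠ 0 := by
    intro h
    apply x.rep_nonzero
    ext i
    simpa [h] using hi₀ i
  have hle : ∀ i, ‖x.rep i / x.rep i₀‖ ≤ 1 := fun i => by
    rw [norm_div]
    exact div_le_one_of_le₀ (hi₀ i) (norm_nonneg _)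
  have hv : (fun i => (((⟨_, hle i⟩ : ℤ_[p])) : ℚ_[p])) ≠ 0 := fun h => by
    simpa [h0] using congrFun h i₀
  refine ⟨fun i => ⟨_, hle i⟩, i₀, hv, ?_, ?_⟩
  · apply PadicInt.ext
    simp [h0]
  · conv_lhs => rw [← x.mk_rep]
    rw [Projectivization.mk_eq_mk_iff']
    refine ⟨x.rep i₀, ?_⟩
    ext i
    simp only [Pi.smul_apply, smul_eq_mul]
    field_simp

lemma pwnorm_eq_norm_sub {p : ℕ} [Fact p.Prime] {N : ℕ} (v : Fin (N + 1) → ℤ_[p])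
    (i₀ : Fin (N + 1)) (hv : v i₀ = 1) (y : Fin (N + 1) → ℚ_[p]) :
    pwnorm (fun i => (v i : ℚ_[p])) y = ‖fun i => y i - v i * y i₀‖ := by
  rw [pwnorm_eq_norm]
  apply le_antisymm
  · rw [pi_norm_le_iff_of_nonempty]
    rintro ⟨i, j⟩
    have h : (v i : ℚ_[p]) * y j - v j * y i =
        v i * (y j - v j * y i₀) - v j * (y i - v i * y i₀) := by ring
    have hb : ∀ i j : Fin (N + 1),
        ‖(v i : ℚ_[p]) * (y j - v j * y i₀)‖ ≤ ‖fun i => y i - v i * y i₀‖ := fun i j => by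
      rw [norm_mul]
      exact (mul_le_of_le_one_left (norm_nonneg _) (v i).2).trans
        (norm_le_pi_norm (fun i => y i - v i * y i₀) j)
    simp only [h]
    rw [sub_eq_add_neg]
    refine (IsUltrametricDist.norm_add_le_max _ _).trans (max_le (hb i j) ?_)
    rw [norm_neg]
    exact hb j i
  · rw [pi_norm_le_iff_of_nonempty]
    intro i
    refine le_trans (le_of_eq ?_) (norm_le_pi_norm _ (i₀, i))
    simp [hv]

lemma norm_integral_eq_one {p : ℕ} [Fact p.Prime] {N : ℕ} (v : Fin (N + 1) → ℤ_[p])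
    (i₀ : Fin (N + 1)) (hv : ‖v i₀‖ = 1) : ‖fun i => (v i : ℚ_[p])‖ = 1 := by
  apply le_antisymm
  · rw [pi_norm_le_iff_of_nonempty]
    exact fun i => (v i).2
  · exact hv.symm.le.trans (norm_le_pi_norm (fun i => (v i : ℚ_[p])) i₀)

lemma coprimeVec.norm_castVecP {p : ℕ} [Fact p.Prime] {N : ℕ} {q : Fin (N + 1) → ℤ}
    (hq : coprimeVec q) : ‖castVecP p q‖ = 1 := by
  have hex : ∃ i, ¬ (p : ℤ) ∣ q i := by
    by_contra! h
    have hdvd : (p : ℤ) ∣ Finset.univ.gcd q := Finset.dvd_gcd fun i _ => h i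
    rw [hq] at hdvd
    have hle := Int.le_of_dvd one_pos hdvd
    have := (Fact.out : p.Prime).two_le
    omega
  obtain ⟨i, hi⟩ := hex
  have h1 : ‖(q i : ℤ_[p])‖ = 1 := by
    refine le_antisymm (PadicInt.norm_le_one _) (not_lt.1 fun hlt => hi ?_)
    exact PadicInt.norm_int_lt_one_iff_dvd (q i) |>.1 hlt
  have hcast : castVecP p q = fun i => (((q i : ℤ_[p])) : ℚ_[p]) := by
    ext i
    simp [castVecP]
  rw [hcast]
  exact norm_integral_eq_one (fun i => (q i : ℤ_[p])) i h1

lemma pdistP_ratPtP {p : ℕ} [Fact p.Prime] {N : ℕ} (v : Fin (N + 1) → ℤ_[p])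
    (i₀ : Fin (N + 1)) (hv : v i₀ = 1) (hv0 : (fun i => (v i : ℚ_[p])) ≠ 0)
    {q : Fin (N + 1) → ℤ} (hq : coprimeVec q) :
    pdistP (Projectivization.mk ℚ_[p] (fun i => (v i : ℚ_[p])) hv0) (ratPtP p q) =
      ‖fun i => (q i : ℚ_[p]) - v i * q i₀‖ := by
  have h1 := hq.norm_castVecP (p := p)
  have hq0 : castVecP p q ≠ 0 := fun h => by simp [h] at h1
  rw [ratPtP, dif_neg hq0, pdistP_mk, pwnorm_eq_norm_sub v i₀ hv, h1,
    norm_integral_eq_one v i₀ (by simp [hv])]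
  simp [castVecP]

lemma eq_ratPtP {p : ℕ} [Fact p.Prime] {N : ℕ} (v : Fin (N + 1) → ℤ_[p])
    (i₀ : Fin (N + 1)) (hv0 : (fun i => (v i : ℚ_[p])) ≠ 0)
    {q : Fin (N + 1) → ℤ} (hq : coprimeVec q)
    (h : ‖fun i => (q i : ℚ_[p]) - v i * q i₀‖ = 0) :
    Projectivization.mk ℚ_[p] (fun i => (v i : ℚ_[p])) hv0 = ratPtP p q := by
  have h1 := hq.norm_castVecP (p := p)
  have hq0 : castVecP p q ≠ 0 := fun h => by simp [h] at h1
  rw [ratPtP, dif_neg hq0, eq_comm, Projectivization.mk_eq_mk_iff']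
  refine ⟨q i₀, ?_⟩
  ext i
  have := congrFun (norm_eq_zero.1 h) i
  simp only [Pi.zero_apply, sub_eq_zero] at this
  simp [castVecP, this, mul_comm]

/-- Dirichlet's pigeonhole argument for simultaneous `p`-adic approximation. -/
lemma exists_small_int_vec {p : ℕ} [Fact p.Prime] {N : ℕ} (v : Fin (N + 1) → ℤ_[p])
    (i₀ : Fin (N + 1)) (hv : v i₀ = 1) (m : ℕ) :
    ∃ q : Fin (N + 1) → ℤ, q ≠ 0 ∧ Ht q ^ (N + 1) ≤ p ^ (m * N) ∧
      ‖fun i => (q i : ℚ_[p]) - v i * q i₀‖ ≤ (p : ℝ) ^ (-(m : ℤ)) := by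
  have hp : 0 < p := (Fact.out : p.Prime).pos
  obtain ⟨B, hB, hB'⟩ : ∃ B : ℕ, B ^ (N + 1) ≤ p ^ (m * N) ∧ p ^ (m * N) < (B + 1) ^ (N + 1) := by
    set P : ℕ → Prop := fun B => p ^ (m * N) < (B + 1) ^ (N + 1) with hP
    have hex : ∃ B, P B := ⟨p ^ (m * N), (Nat.lt_succ_self _).trans_le
      (Nat.le_self_pow (Nat.succ_ne_zero N) _)⟩
    refine ⟨Nat.find hex, ?_, Nat.find_spec hex⟩
    rcases Nat.eq_zero_or_pos (Nat.find hex) with h | h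
    · simp [h]
    · have := Nat.find_min hex (Nat.sub_lt h one_pos)
      simp only [hP, not_lt] at this
      rwa [show Nat.find hex - 1 + 1 = Nat.find hex from Nat.sub_add_cancel h] at this
  have : NeZero (p ^ m) := ⟨(pow_pos hp m).ne'⟩
  let f : (Fin (N + 1) → Fin (B + 1)) → ({i // i ≠ i₀} → ZMod (p ^ m)) := fun a i =>
    PadicInt.toZModPow m (((a i : ℕ) : ℤ_[p]) - v i * ((a i₀ : ℕ) : ℤ_[p]))
  have hcard : Fintype.card ({i // i ≠ i₀} → ZMod (p ^ m)) <
      Fintype.card (Fin (N + 1) → Fin (B + 1)) := by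
    simp only [Fintype.card_pi, Finset.prod_const, Finset.card_univ, Fintype.card_fin, ZMod.card,
      Fintype.card_subtype_compl, Fintype.card_subtype_eq, ← pow_mul]
    simpa using hB'
  obtain ⟨a, b, hab, hf⟩ := Fintype.exists_ne_map_eq_of_card_lt f hcard
  refine ⟨fun i => (a i : ℤ) - (b i : ℤ), ?_, ?_, ?_⟩
  · intro h
    apply hab
    ext i
    have := congrFun h i
    simp only [Pi.zero_apply] at this
    omega
  · refine le_trans (Nat.pow_le_pow_left ?_ _) hB
    refine Finset.sup_le fun i _ => ?_
    have := (a i).2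
    have := (b i).2
    dsimp only
    omega
  · rw [pi_norm_le_iff_of_nonempty]
    intro i
    by_cases hi : i = i₀
    · subst hi
      simp only [hv, PadicInt.coe_one, one_mul, sub_self, norm_zero]
      positivity
    · have h := congrFun hf ⟨i, hi⟩
      simp only [f] at h
      rw [← sub_eq_zero, ← map_sub, ← RingHom.mem_ker, PadicInt.ker_toZModPow,
        ← PadicInt.norm_le_pow_iff_mem_span_pow] at h
      refine le_trans (le_of_eq ?_) h
      rw [PadicInt.norm_def]
      push_cast
      congr 1
      ring

lemma one_le_mul_norm_natCast (p : ℕ) [Fact p.Prime] {d : ℕ} (hd : 0 < d) :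
    1 ≤ (d : ℝ) * ‖(d : ℚ_[p])‖ := by
  have hp : (0 : ℝ) < p := by exact_mod_cast (Fact.out : p.Prime).pos
  rw [Padic.norm_eq_zpow_neg_valuation (by exact_mod_cast hd.ne'), Padic.valuation_natCast,
    zpow_neg, zpow_natCast, ← div_eq_mul_inv, one_le_div (by positivity)]
  exact_mod_cast Nat.le_of_dvd hd pow_padicValNat_dvd

lemma Ht_natCast_smul {N : ℕ} (d : ℕ) (q : Fin (N + 1) → ℤ) :
    Ht (fun i => (d : ℤ) * q i) = d * Ht q := by
  simp only [Ht, Int.natAbs_mul, Int.natAbs_natCast]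
  rw [Finset.mul_sup₀]

lemma exists_eq_gcd_mul {N : ℕ} {q : Fin (N + 1) → ℤ} (hq : q ≠ 0) :
    ∃ (d : ℕ) (r : Fin (N + 1) → ℤ), 0 < d ∧ coprimeVec r ∧ q = fun i => (d : ℤ) * r i := by
  obtain ⟨i, hi⟩ := Function.ne_iff.1 hq
  obtain ⟨r, hr, hr'⟩ := Finset.extract_gcd q (Finset.univ_nonempty (α := Fin (N + 1)))
  have hnn : 0 ≤ Finset.univ.gcd q := by
    rw [← Finset.normalize_gcd]
    exact Int.nonneg_of_normalize_eq_self (normalize_idem _)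
  have hg : Finset.univ.gcd q ≠ 0 := fun h => hi (by simp [hr i (Finset.mem_univ i), h])
  refine ⟨(Finset.univ.gcd q).natAbs, r, Int.natAbs_pos.2 hg, hr', ?_⟩
  ext i
  rw [Int.natAbs_of_nonneg hnn]
  exact hr i (Finset.mem_univ i)

lemma coprimeVec.Ht_pos {N : ℕ} {q : Fin (N + 1) → ℤ} (hq : coprimeVec q) : 0 < Ht q := by
  rw [Nat.pos_iff_ne_zero]
  intro h
  have h0 : ∀ i ∈ Finset.univ, q i = 0 := fun i hi => by
    have := (Finset.sup_eq_bot_iff _ _).1 h i hi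
    simpa using this
  have := Finset.gcd_eq_zero_iff.2 h0
  rw [hq] at this
  exact one_ne_zero this

lemma exists_coprimeVec_approx {p : ℕ} [Fact p.Prime] {N : ℕ} (v : Fin (N + 1) → ℤ_[p])
    (i₀ : Fin (N + 1)) (hv : v i₀ = 1) (m : ℕ) :
    ∃ q : Fin (N + 1) → ℤ, coprimeVec q ∧
      ‖fun i => (q i : ℚ_[p]) - v i * q i₀‖ ^ N * (Ht q : ℝ) ^ (N + 1) ≤ 1 ∧
      ‖fun i => (q i : ℚ_[p]) - v i * q i₀‖ ^ (N + 1) ≤ ((p : ℝ)⁻¹) ^ m := by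
  obtain ⟨q, hq0, hH, hδ⟩ := exists_small_int_vec v i₀ hv m
  obtain ⟨d, r, hd, hr, rfl⟩ := exists_eq_gcd_mul hq0
  refine ⟨r, hr, ?_⟩
  have hp : (0 : ℝ) < p := by exact_mod_cast (Fact.out : p.Prime).pos
  have hd1 : (1 : ℝ) ≤ d := by exact_mod_cast hd
  have hr1 : (1 : ℝ) ≤ Ht r := by exact_mod_cast hr.Ht_pos
  rw [Ht_natCast_smul] at hH
  have hH' : ((d : ℝ) * Ht r) ^ (N + 1) ≤ (p : ℝ) ^ (m * N) := by exact_mod_cast hH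
  have hz : (fun i => ((((d : ℤ) * r i : ℤ)) : ℚ_[p]) - v i * (((d : ℤ) * r i₀ : ℤ) : ℚ_[p])) =
      (d : ℚ_[p]) • fun i => (r i : ℚ_[p]) - v i * r i₀ := by
    ext i
    simp only [Pi.smul_apply, smul_eq_mul]
    push_cast
    ring
  rw [hz, norm_smul, zpow_neg, zpow_natCast] at hδ
  set δ := ‖fun i => (r i : ℚ_[p]) - v i * r i₀‖
  have hδ0 : 0 ≤ δ := norm_nonneg _
  have hle : δ ≤ d * ((p : ℝ) ^ m)⁻¹ := by
    calc δ ≤ (d * ‖(d : ℚ_[p])‖) * δ := le_mul_of_one_le_left hδ0 (one_le_mul_norm_natCast p hd)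
      _ = d * (‖(d : ℚ_[p])‖ * δ) := mul_assoc _ _ _
      _ ≤ _ := by gcongr
  constructor
  · calc δ ^ N * (Ht r : ℝ) ^ (N + 1)
        ≤ (d * ((p : ℝ) ^ m)⁻¹) ^ N * (Ht r : ℝ) ^ (N + 1) := by gcongr
      _ ≤ d * ((d * ((p : ℝ) ^ m)⁻¹) ^ N * (Ht r : ℝ) ^ (N + 1)) :=
          le_mul_of_one_le_left (by positivity) hd1
      _ = (d * Ht r) ^ (N + 1) * ((p : ℝ) ^ (m * N))⁻¹ := by
          rw [pow_mul, mul_pow, mul_pow, inv_pow]; ring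
      _ ≤ (p : ℝ) ^ (m * N) * ((p : ℝ) ^ (m * N))⁻¹ := by gcongr
      _ = 1 := mul_inv_cancel₀ (by positivity)
  · calc δ ^ (N + 1) ≤ (d * ((p : ℝ) ^ m)⁻¹) ^ (N + 1) := by gcongr
      _ ≤ (d * Ht r * ((p : ℝ) ^ m)⁻¹) ^ (N + 1) := by
          gcongr
          exact le_mul_of_one_le_right (by positivity) hr1
      _ = (d * Ht r) ^ (N + 1) * (((p : ℝ) ^ m)⁻¹) ^ (N + 1) := mul_pow _ _ _
      _ ≤ (p : ℝ) ^ (m * N) * (((p : ℝ) ^ m)⁻¹) ^ (N + 1) := by gcongr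
      _ = ((p : ℝ)⁻¹) ^ m := by
          rw [pow_mul, pow_succ, inv_pow, inv_pow]
          field_simp

lemma lt_two_div_rpow {N : ℕ} (hN : 1 ≤ N) {δ H : ℝ} (hδ : 0 ≤ δ) (hH : 0 < H)
    (h : δ ^ N * H ^ (N + 1) ≤ 1) : δ < 2 / H ^ ((N + 1 : ℝ) / N) := by
  have hN0 : N ≠ 0 := by omega
  have hN' : (N : ℝ) ≠ 0 := by exact_mod_cast hN0
  have hpow : (H ^ ((N + 1 : ℝ) / N)) ^ N = H ^ (N + 1) := by
    rw [← Real.rpow_natCast, ← Real.rpow_mul hH.le, div_mul_cancel₀ _ hN']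
    exact_mod_cast Real.rpow_natCast H (N + 1)
  have hR : 0 < H ^ ((N + 1 : ℝ) / N) := Real.rpow_pos_of_pos hH _
  rw [lt_div_iff₀ hR]
  have h1 : δ * H ^ ((N + 1 : ℝ) / N) ≤ 1 := by
    rw [← pow_le_one_iff_of_nonneg (by positivity) hN0, mul_pow, hpow]
    exact h
  linarith

theorem stmt17 (N : ℕ) (hN : 1 ≤ N) (p : ℕ) [Fact p.Prime] :
    ∃ c : ℝ, 0 < c ∧ ∀ x : PProj p N,
      (¬ ∃ q : Fin (N + 1) → ℤ, coprimeVec q ∧ x = ratPtP p q) →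
      {q : Fin (N + 1) → ℤ | coprimeVec q ∧
        pdistP x (ratPtP p q) < c / (Ht q : ℝ) ^ ((N + 1 : ℝ) / N)}.Infinite := by
  refine ⟨2, two_pos, fun x hx => ?_⟩
  obtain ⟨v, i₀, hv0, hv, rfl⟩ := PProj.exists_integral_coords x
  intro hfin
  let δ : (Fin (N + 1) → ℤ) → ℝ := fun q => ‖fun i => (q i : ℚ_[p]) - v i * q i₀‖
  have hpos : ∀ q, coprimeVec q → 0 < δ q := fun q hq =>
    lt_of_le_of_ne (norm_nonneg _) fun h => hx ⟨q, hq, eq_ratPtP v i₀ hv0 hq h.symm⟩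
  obtain ⟨ε, hε, hεle⟩ : ∃ ε : ℝ, 0 < ε ∧ ∀ q, coprimeVec q →
      pdistP (Projectivization.mk ℚ_[p] (fun i => (v i : ℚ_[p])) hv0) (ratPtP p q) <
        2 / (Ht q : ℝ) ^ ((N + 1 : ℝ) / N) → ε ≤ δ q := by
    rcases Set.eq_empty_or_nonempty {q : Fin (N + 1) → ℤ | coprimeVec q ∧
        pdistP (Projectivization.mk ℚ_[p] (fun i => (v i : ℚ_[p])) hv0) (ratPtP p q) <
          2 / (Ht q : ℝ) ^ ((N + 1 : ℝ) / N)} with he | hne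
    · exact ⟨1, one_pos, fun q hq h => (Set.eq_empty_iff_forall_notMem.1 he q ⟨hq, h⟩).elim⟩
    · obtain ⟨q₀, hq₀, hmin⟩ := Set.exists_min_image _ δ hfin hne
      exact ⟨δ q₀, hpos q₀ hq₀.1, fun q hq h => hmin q ⟨hq, h⟩⟩
  have hp1 : (p : ℝ)⁻¹ < 1 :=
    inv_lt_one_of_one_lt₀ (by exact_mod_cast (Fact.out : p.Prime).one_lt)
  obtain ⟨m, hm⟩ := exists_pow_lt_of_lt_one (pow_pos hε (N + 1)) hp1
  obtain ⟨q, hq, hqH, hqm⟩ := exists_coprimeVec_approx v i₀ hv m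
  have hlt := lt_two_div_rpow hN (norm_nonneg _) (by exact_mod_cast hq.Ht_pos) hqH
  rw [← pdistP_ratPtP v i₀ hv hv0 hq] at hlt
  exact absurd (pow_le_pow_left₀ hε.le (hεle q hq hlt) (N + 1)) (not_le.2 (hqm.trans_lt hm))

end
end
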